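/- Let g : [0,∞)² → ℝ be a continuous function with g(t,0) = g(0,t) = 0 for all t ≥ 0. The following are equivalent: (i) the kernel ((x,u),(y,v)) ↦ g(‖x−y‖², ‖u−v‖²) on (ℝ^d×ℝ^{d'})×(ℝ^d×ℝ^{d'}) is positive definite independent for every d, d' ∈ ℕ; (ii) g(t₁,t₂) = ∫_{[0,∞)²} ((1−e^{−r₁t₁})/r₁)((1−e^{−r₂t₂})/r₂)(1+r₁)(1+r₂) dσ(r₁,r₂) for some finite nonnegative Radon measure σ on [0,∞)²; (iii) g is a Bernstein function of two variables. -/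

import Mathlib

open MeasureTheory Set Finset

noncomputable section

/-- A symmetric kernel `𝔍 : (X × Y) × (X × Y) → ℝ` is positive definite independent (PDI). -/
def IsPDI {X Y : Type*} (J : X × Y → X × Y → ℝ) : Prop :=
  ∀ (n m : ℕ) (x : Fin n → X) (y : Fin m → Y) (c : Fin n → Fin m → ℝ),
    (∀ k, ∑ i, c i k = 0) → (∀ i, ∑ k, c i k = 0) →
    0 ≤ ∑ i, ∑ j, ∑ k, ∑ l, c i k * c j l * J (x i, y k) (x j, y l)

/-- First partial derivative operator. -/
def pd1 (g : ℝ → ℝ → ℝ) : ℝ → ℝ → ℝ := fun s t => deriv (fun u => g u t) s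

/-- Second partial derivative operator. -/
def pd2 (g : ℝ → ℝ → ℝ) : ℝ → ℝ → ℝ := fun s t => deriv (fun u => g s u) t

/-- Bernstein function of two variables. -/
def IsBernstein2 (g : ℝ → ℝ → ℝ) : Prop :=
  ContinuousOn (fun p : ℝ × ℝ => g p.1 p.2) (Set.Ici 0 ×ˢ Set.Ici 0) ∧
  ContDiffOn ℝ ((⊤ : ℕ∞) : WithTop ℕ∞) (fun p : ℝ × ℝ => g p.1 p.2)
    (Set.Ioi 0 ×ˢ Set.Ioi 0) ∧
  ∀ (i j : ℕ) (s t : ℝ), 0 < s → 0 < t →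
    0 ≤ (-1 : ℝ) ^ (i + j) * (pd1^[i] (pd2^[j] (pd1 (pd2 g)))) s t

/-- The integrand `(1 - e^{-r s})/r`, whose value at `r = 0` is its limit `s`. -/
def G10 (r : NNReal) (s : ℝ) : ℝ :=
  if r = 0 then s else (1 - Real.exp (-(r : ℝ) * s)) / (r : ℝ)

section MomentProblem

open Filter Topology Polynomial unitInterval

lemma exists_measure_of_mass_le {K : Type*} [TopologicalSpace K] [CompactSpace K] [T2Space K]
    [MeasurableSpace K] [BorelSpace K] (μ : ℕ → FiniteMeasure K) (C : NNReal)
    (hC : ∀ n, (μ n).mass ≤ C) :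
    ∃ ν : FiniteMeasure K, ∀ (f : K → ℝ) (_ : Continuous f) (c : ℝ),
      Tendsto (fun n => ∫ x, f x ∂(μ n : Measure K)) atTop (𝓝 c) →
      ∫ x, f x ∂(ν : Measure K) = c := by
  obtain ⟨ν, -, hν⟩ :=
    (isCompact_setOfPred_finiteMeasure_le_of_compactSpace K C).exists_mapClusterPt
    (f := atTop) (u := μ) (Filter.tendsto_principal.2 (Filter.Eventually.of_forall hC))
  refine ⟨ν, fun f hf c hc => ?_⟩
  have hcont : Continuous (fun m : FiniteMeasure K => ∫ x, f x ∂(m : Measure K)) := by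
    rw [continuous_iff_continuousAt]
    intro m
    exact (FiniteMeasure.tendsto_iff_forall_integral_tendsto.1 tendsto_id)
      (BoundedContinuousFunction.mkOfCompact ⟨f, hf⟩)
  obtain ⟨φ, hφ, hlim⟩ := (hν.continuousAt_comp hcont.continuousAt).tendsto_subseq
  exact tendsto_nhds_unique hlim (hc.comp hφ.tendsto_atTop)

/-- The bilinear form on polynomials sending `(X ^ i, X ^ j)` to `a i j`. -/
def momentForm (a : ℕ → ℕ → ℝ) : ℝ[X] →ₗ[ℝ] ℝ[X] →ₗ[ℝ] ℝ :=
  (Polynomial.basisMonomials ℝ).constr ℝ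
    (fun i => (Polynomial.basisMonomials ℝ).constr ℝ (fun j => a i j))

lemma momentForm_X_pow (a : ℕ → ℕ → ℝ) (i j : ℕ) :
    momentForm a (X ^ i) (X ^ j) = a i j := by
  have h (n : ℕ) : (X ^ n : ℝ[X]) = Polynomial.basisMonomials ℝ n := by
    simp [Polynomial.monomial_one_right_eq_X_pow]
  rw [momentForm, h i, h j, Module.Basis.constr_basis, Module.Basis.constr_basis]

/-- Complete monotonicity of a double sequence, expressed through its moment form. -/
def CompletelyMonotoneSeq (a : ℕ → ℕ → ℝ) : Prop :=
  ∀ p q i j : ℕ, 0 ≤ momentForm a (X ^ i * (1 - X) ^ p) (X ^ j * (1 - X) ^ q)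

lemma CompletelyMonotoneSeq.bernstein_nonneg {a : ℕ → ℕ → ℝ} (ha : CompletelyMonotoneSeq a)
    (n k l : ℕ) :
    0 ≤ momentForm a (bernsteinPolynomial ℝ n k) (bernsteinPolynomial ℝ n l) := by
  have h (k : ℕ) : bernsteinPolynomial ℝ n k
      = ((n.choose k : ℕ) : ℝ) • (X ^ k * (1 - X) ^ (n - k)) := by
    rw [bernsteinPolynomial, Polynomial.smul_eq_C_mul]
    simp [mul_assoc]
  rw [h k, h l]
  simp only [map_smul, LinearMap.smul_apply, smul_eq_mul]
  have := ha (n - k) (n - l) k l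
  positivity

lemma sum_descFactorial_smul_bernsteinPolynomial (m : ℕ) :
    ∀ n : ℕ, ∑ k ∈ Finset.range (n + 1), (k.descFactorial m : ℝ) • bernsteinPolynomial ℝ n k
      = (n.descFactorial m : ℝ) • (X ^ m : ℝ[X]) := by
  induction m with
  | zero => intro n; simp [bernsteinPolynomial.sum]
  | succ m ih =>
    intro n
    cases n with
    | zero => simp
    | succ n =>
      rw [Finset.sum_range_succ']
      have h (k : ℕ) : ((k + 1).descFactorial (m + 1) : ℝ) • bernsteinPolynomial ℝ (n + 1) (k + 1)
          = (((n : ℝ) + 1) • (X : ℝ[X])) * ((k.descFactorial m : ℝ) • bernsteinPolynomial ℝ n k) :=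
          by
        have hc : ((n : ℝ[X]) + 1) * (n.choose k : ℝ[X])
            = ((n + 1).choose (k + 1) : ℝ[X]) * ((k : ℝ[X]) + 1) := by
          exact_mod_cast congrArg (Nat.cast (R := ℝ[X])) (Nat.add_one_mul_choose_eq n k)
        simp only [bernsteinPolynomial, Polynomial.smul_eq_C_mul, Nat.succ_descFactorial_succ,
          Nat.succ_sub_succ]
        simp only [map_add, map_natCast, map_one, Nat.cast_mul, Nat.cast_add, Nat.cast_one, map_mul]
        linear_combination (-(k.descFactorial m : ℝ[X]) * X ^ (k + 1) * (1 - X) ^ (n - k)) * hc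
      simp only [h]
      rw [← Finset.mul_sum, ih n, Nat.succ_descFactorial_succ n m, Nat.zero_descFactorial_succ]
      simp only [Polynomial.smul_eq_C_mul, Nat.cast_mul, Nat.cast_zero, map_mul, Nat.cast_add,
        Nat.cast_one, map_zero, zero_mul, add_zero]
      ring

lemma eventually_abs_div_pow_sub_descFactorial_le (m : ℕ) :
    ∀ ε > (0 : ℝ), ∀ᶠ M : ℕ in atTop, ∀ k ≤ M,
      |((k : ℝ) / M) ^ m - (k.descFactorial m : ℝ) / M.descFactorial m| ≤ ε := by
  induction m with
  | zero => intro ε hε; simp [hε.le]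
  | succ m ih =>
    intro ε hε
    have h2 : ∀ᶠ M : ℕ in atTop, (m : ℝ) / ((M : ℝ) - m) ≤ ε / 2 := by
      have : Tendsto (fun M : ℕ => (m : ℝ) / ((M : ℝ) - m)) atTop (𝓝 0) :=
        tendsto_const_nhds.div_atTop
          (tendsto_atTop_add_const_right _ (-(m : ℝ)) tendsto_natCast_atTop_atTop)
      exact (this.eventually (gt_mem_nhds (half_pos hε))).mono fun _ h => h.le
    filter_upwards [ih (ε / 2) (half_pos hε), h2, eventually_gt_atTop m] with M h1 h2 hM k hk
    have hMm : (0 : ℝ) < (M : ℝ) - m := by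
      have : (m : ℝ) < M := by exact_mod_cast hM
      linarith
    have hM0 : (0 : ℝ) < M := by
      have : (0 : ℝ) ≤ m := by positivity
      linarith
    have hkM : (k : ℝ) ≤ M := by exact_mod_cast hk
    rw [Nat.descFactorial_succ, Nat.descFactorial_succ, Nat.cast_mul, Nat.cast_mul,
      Nat.cast_sub hM.le]
    have hstep : |(k : ℝ) / M - ((k - m : ℕ) : ℝ) / ((M : ℝ) - m)| ≤ ε / 2 := by
      refine le_trans ?_ h2
      rcases le_total m k with hmk | hkm
      · rw [Nat.cast_sub hmk]
        have : (k : ℝ) / M - ((k : ℝ) - m) / ((M : ℝ) - m)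
            = (m / (M - m)) * ((M - k) / M) := by
          field_simp; ring
        rw [this, abs_of_nonneg (by have : (0:ℝ) ≤ M - k := by linarith
                                    positivity)]
        refine mul_le_of_le_one_right (by positivity) ?_
        rw [div_le_one hM0]
        have : (0 : ℝ) ≤ k := by positivity
        linarith
      · rw [Nat.sub_eq_zero_of_le hkm]
        have : (k : ℝ) ≤ m := by exact_mod_cast hkm
        simp only [Nat.cast_zero, zero_div, sub_zero]
        rw [abs_of_nonneg (by positivity)]
        have : (0 : ℝ) ≤ m := by positivity
        gcongr
        linarith
    have hr1 : (k : ℝ) / M ≤ 1 := div_le_one_of_le₀ hkM hM0.le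
    have hr0 : 0 ≤ (k : ℝ) / M := by positivity
    have hd0 : 0 ≤ (k.descFactorial m : ℝ) / M.descFactorial m := by positivity
    have hd1 : (k.descFactorial m : ℝ) / M.descFactorial m ≤ 1 := by
      refine div_le_one_of_le₀ ?_ (by positivity)
      exact_mod_cast Nat.descFactorial_le m hk
    have key : ((k : ℝ) / M) ^ (m + 1)
        - ((k - m : ℕ) : ℝ) * k.descFactorial m / (((M : ℝ) - m) * M.descFactorial m)
        = (((k : ℝ) / M) ^ m - (k.descFactorial m : ℝ) / M.descFactorial m) * ((k : ℝ) / M)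
          + (k.descFactorial m : ℝ) / M.descFactorial m
            * ((k : ℝ) / M - ((k - m : ℕ) : ℝ) / ((M : ℝ) - m)) := by
      rw [mul_div_mul_comm]; ring
    rw [key]
    refine (abs_add_le _ _).trans ?_
    rw [abs_mul, abs_mul, abs_of_nonneg hr0, abs_of_nonneg hd0]
    have e1 := mul_le_of_le_one_right (abs_nonneg (((k : ℝ) / M) ^ m
      - (k.descFactorial m : ℝ) / M.descFactorial m)) hr1
    have e2 := mul_le_of_le_one_left
      (abs_nonneg ((k : ℝ) / M - ((k - m : ℕ) : ℝ) / ((M : ℝ) - m))) hd1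
    have e3 := h1 k hk
    linarith

/-- The discrete measure on the square placing the Bernstein coefficients of the moment form
on the uniform grid of mesh `1 / M`. -/
def bernsteinMeasure (a : ℕ → ℕ → ℝ) (M : ℕ) : Measure (I × I) :=
  ∑ k ∈ Finset.range (M + 1), ∑ l ∈ Finset.range (M + 1),
    ENNReal.ofReal (momentForm a (bernsteinPolynomial ℝ M k) (bernsteinPolynomial ℝ M l)) •
      Measure.dirac (Set.projIcc 0 1 zero_le_one ((k : ℝ) / M),
        Set.projIcc 0 1 zero_le_one ((l : ℝ) / M))

instance (a : ℕ → ℕ → ℝ) (M : ℕ) : IsFiniteMeasure (bernsteinMeasure a M) := by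
  constructor
  simp only [bernsteinMeasure, Measure.coe_finsetSum, Finset.sum_apply, Measure.smul_apply,
    measure_univ, smul_eq_mul, mul_one, ENNReal.sum_lt_top]
  intros
  exact ENNReal.ofReal_lt_top

lemma integral_bernsteinMeasure {a : ℕ → ℕ → ℝ} (ha : CompletelyMonotoneSeq a) (M : ℕ)
    (f : I × I → ℝ) :
    ∫ x, f x ∂(bernsteinMeasure a M) = ∑ k ∈ Finset.range (M + 1), ∑ l ∈ Finset.range (M + 1),
      momentForm a (bernsteinPolynomial ℝ M k) (bernsteinPolynomial ℝ M l) *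
        f (Set.projIcc 0 1 zero_le_one ((k : ℝ) / M),
          Set.projIcc 0 1 zero_le_one ((l : ℝ) / M)) := by
  have hintegrable (k l : ℕ) : Integrable f (ENNReal.ofReal
      (momentForm a (bernsteinPolynomial ℝ M k) (bernsteinPolynomial ℝ M l)) •
      Measure.dirac (Set.projIcc (0 : ℝ) 1 zero_le_one ((k : ℝ) / M),
        Set.projIcc (0 : ℝ) 1 zero_le_one ((l : ℝ) / M))) :=
    (integrable_dirac (by simp)).smul_measure ENNReal.ofReal_ne_top
  rw [bernsteinMeasure, integral_finsetSum_measure]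
  · refine Finset.sum_congr rfl fun k _ => ?_
    rw [integral_finsetSum_measure fun l _ => hintegrable k l]
    refine Finset.sum_congr rfl fun l _ => ?_
    rw [integral_smul_measure, integral_dirac, ENNReal.toReal_ofReal (ha.bernstein_nonneg M k l),
      smul_eq_mul]
  · intro k _
    exact integrable_finsetSum_measure.2 fun l _ => hintegrable k l

lemma sum_sum_momentForm_bernsteinPolynomial (a : ℕ → ℕ → ℝ) {M m n : ℕ} (hm : m ≤ M)
    (hn : n ≤ M) :
    ∑ k ∈ Finset.range (M + 1), ∑ l ∈ Finset.range (M + 1),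
      momentForm a (bernsteinPolynomial ℝ M k) (bernsteinPolynomial ℝ M l) *
        (((k.descFactorial m : ℝ) / M.descFactorial m) *
          ((l.descFactorial n : ℝ) / M.descFactorial n)) = a m n := by
  have hX {m : ℕ} (hm : m ≤ M) : (X ^ m : ℝ[X]) = ∑ k ∈ Finset.range (M + 1),
      ((k.descFactorial m : ℝ) / M.descFactorial m) • bernsteinPolynomial ℝ M k := by
    have h0 : (M.descFactorial m : ℝ) ≠ 0 := by
      exact_mod_cast (Nat.descFactorial_pos.2 hm).ne'
    have := congrArg (fun p => (M.descFactorial m : ℝ)⁻¹ • p)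
      (sum_descFactorial_smul_bernsteinPolynomial m M)
    simp only [smul_smul, inv_mul_cancel₀ h0, one_smul, Finset.smul_sum] at this
    rw [← this]
    refine Finset.sum_congr rfl fun k _ => ?_
    rw [div_eq_inv_mul]
  rw [← momentForm_X_pow a m n, hX hm, hX hn]
  simp only [map_sum, map_smul, LinearMap.sum_apply, LinearMap.smul_apply, smul_eq_mul,
    Finset.mul_sum]
  rw [Finset.sum_comm]
  refine (Finset.sum_congr rfl fun k _ => Finset.sum_congr rfl fun l _ => ?_)
  ring

lemma tendsto_integral_bernsteinMeasure {a : ℕ → ℕ → ℝ} (ha : CompletelyMonotoneSeq a)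
    (m n : ℕ) :
    Tendsto (fun M => ∫ x : I × I, (x.1 : ℝ) ^ m * (x.2 : ℝ) ^ n ∂(bernsteinMeasure a M)) atTop
      (𝓝 (a m n)) := by
  have h00 (M : ℕ) := sum_sum_momentForm_bernsteinPolynomial a (Nat.zero_le M) (Nat.zero_le M)
  simp only [Nat.descFactorial_zero, Nat.cast_one, div_one, mul_one] at h00
  have ha0 : 0 ≤ a 0 0 := by
    rw [← h00 0]
    exact Finset.sum_nonneg fun k _ => Finset.sum_nonneg fun l _ => ha.bernstein_nonneg 0 k l
  rw [Metric.tendsto_nhds]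
  intro ε hε
  set δ : ℝ := ε / (2 * (a 0 0 + 1)) with hδ
  have hδ0 : 0 < δ := by positivity
  filter_upwards [eventually_abs_div_pow_sub_descFactorial_le m δ hδ0,
    eventually_abs_div_pow_sub_descFactorial_le n δ hδ0, eventually_ge_atTop m,
    eventually_ge_atTop n] with M h1 h2 hm hn
  rw [integral_bernsteinMeasure ha, Real.dist_eq,
    ← sum_sum_momentForm_bernsteinPolynomial a hm hn, ← Finset.sum_sub_distrib]
  simp only [← Finset.sum_sub_distrib, ← mul_sub]
  have hbound : ∀ k ∈ Finset.range (M + 1), ∀ l ∈ Finset.range (M + 1),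
      |momentForm a (bernsteinPolynomial ℝ M k) (bernsteinPolynomial ℝ M l) *
        (((Set.projIcc (0 : ℝ) 1 zero_le_one ((k : ℝ) / M) : I) : ℝ) ^ m *
          ((Set.projIcc (0 : ℝ) 1 zero_le_one ((l : ℝ) / M) : I) : ℝ) ^ n -
        ((k.descFactorial m : ℝ) / M.descFactorial m) *
          ((l.descFactorial n : ℝ) / M.descFactorial n))| ≤
      momentForm a (bernsteinPolynomial ℝ M k) (bernsteinPolynomial ℝ M l) * (2 * δ) := by
    intro k hk l hl
    rw [Finset.mem_range, Nat.lt_succ_iff] at hk hl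
    have hmem {k : ℕ} (hk : k ≤ M) : (k : ℝ) / M ∈ Set.Icc (0 : ℝ) 1 :=
      ⟨by positivity, div_le_one_of_le₀ (by exact_mod_cast hk) (by positivity)⟩
    rw [Set.projIcc_of_mem _ (hmem hk), Set.projIcc_of_mem _ (hmem hl), abs_mul,
      abs_of_nonneg (ha.bernstein_nonneg M k l)]
    refine mul_le_mul_of_nonneg_left ?_ (ha.bernstein_nonneg M k l)
    have e1 := h1 k hk
    have e2 := h2 l hl
    have hd0 : 0 ≤ (k.descFactorial m : ℝ) / M.descFactorial m := by positivity
    have hd1 : (k.descFactorial m : ℝ) / M.descFactorial m ≤ 1 := by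
      refine div_le_one_of_le₀ ?_ (by positivity)
      exact_mod_cast Nat.descFactorial_le m hk
    have hr0 : 0 ≤ ((l : ℝ) / M) ^ n := by positivity
    have hr1 : ((l : ℝ) / M) ^ n ≤ 1 := pow_le_one₀ (hmem hl).1 (hmem hl).2
    have key : ((k : ℝ) / M) ^ m * ((l : ℝ) / M) ^ n -
        ((k.descFactorial m : ℝ) / M.descFactorial m) *
          ((l.descFactorial n : ℝ) / M.descFactorial n)
        = (((k : ℝ) / M) ^ m - (k.descFactorial m : ℝ) / M.descFactorial m) * ((l : ℝ) / M) ^ n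
          + (k.descFactorial m : ℝ) / M.descFactorial m *
            (((l : ℝ) / M) ^ n - (l.descFactorial n : ℝ) / M.descFactorial n) := by ring
    change |((k : ℝ) / M) ^ m * ((l : ℝ) / M) ^ n - _| ≤ _
    rw [key]
    refine (abs_add_le _ _).trans ?_
    rw [abs_mul, abs_mul, abs_of_nonneg hr0, abs_of_nonneg hd0]
    have e3 := mul_le_of_le_one_right (abs_nonneg (((k : ℝ) / M) ^ m
      - (k.descFactorial m : ℝ) / M.descFactorial m)) hr1
    have e4 := mul_le_of_le_one_left (abs_nonneg (((l : ℝ) / M) ^ n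
      - (l.descFactorial n : ℝ) / M.descFactorial n)) hd1
    linarith
  refine lt_of_le_of_lt ((Finset.abs_sum_le_sum_abs _ _).trans (Finset.sum_le_sum fun k hk =>
    (Finset.abs_sum_le_sum_abs _ _).trans (Finset.sum_le_sum fun l hl => hbound k hk l hl))) ?_
  simp only [← Finset.sum_mul]
  rw [h00 M, hδ]
  have : a 0 0 * (2 * (ε / (2 * (a 0 0 + 1)))) = ε * (a 0 0 / (a 0 0 + 1)) := by
    field_simp
  rw [this]
  refine mul_lt_of_lt_one_right hε ?_
  rw [div_lt_one (by positivity)]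
  linarith

/-- Solution of the Hausdorff moment problem on the unit square. -/
theorem CompletelyMonotoneSeq.exists_measure {a : ℕ → ℕ → ℝ} (ha : CompletelyMonotoneSeq a) :
    ∃ μ : FiniteMeasure (I × I), ∀ m n : ℕ,
      ∫ x : I × I, (x.1 : ℝ) ^ m * (x.2 : ℝ) ^ n ∂(μ : Measure (I × I)) = a m n := by
  obtain ⟨μ, hμ⟩ := exists_measure_of_mass_le
    (fun M => (⟨bernsteinMeasure a M, inferInstance⟩ : FiniteMeasure (I × I)))
    (a 0 0).toNNReal (fun M => by
      have h := integral_bernsteinMeasure ha M (fun _ => 1)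
      have h00 := sum_sum_momentForm_bernsteinPolynomial a (Nat.zero_le M) (Nat.zero_le M)
      simp only [Nat.descFactorial_zero, Nat.cast_one, div_one, mul_one] at h00
      simp only [mul_one, h00, integral_const, smul_eq_mul] at h
      rw [← h, ← NNReal.coe_le_coe]
      simp [FiniteMeasure.mass, Measure.real, ENNReal.coe_toNNReal_eq_toReal])
  exact ⟨μ, fun m n => hμ _ (by fun_prop) _ (tendsto_integral_bernsteinMeasure ha m n)⟩

/-- The rectangular increment of `g` over `[s, s + h] × [t, t + k]`. -/
def mixedDiff (g : ℝ → ℝ → ℝ) (h k s t : ℝ) : ℝ :=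
  (g (s + h) (t + k) - g (s + h) t) - (g s (t + k) - g s t)

lemma sum_sum_mixedDiff (g : ℝ → ℝ → ℝ) (h : ℝ) (i j : ℕ) :
    ∑ a ∈ Finset.range i, ∑ b ∈ Finset.range j, mixedDiff g h h (a * h) (b * h) =
      (g (i * h) (j * h) - g (i * h) 0) - (g 0 (j * h) - g 0 0) := by
  have h1 (x : ℝ) : ∑ b ∈ Finset.range j, (g x (b * h + h) - g x (b * h)) =
      g x (j * h) - g x 0 := by
    have := Finset.sum_range_sub (fun b : ℕ => g x (b * h)) j
    simpa [add_mul] using this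
  simp only [mixedDiff, Finset.sum_sub_distrib (f := fun b : ℕ => _ - _), h1]
  have := Finset.sum_range_sub (fun a : ℕ => g (a * h) (j * h) - g (a * h) 0) i
  simpa [add_mul] using this

/-- The slope `(x ^ s - 1) / (x - 1)`, with value `s` at `x = 1`. -/
def powSlope (s x : ℝ) : ℝ := dslope (fun y : ℝ => y ^ s) 1 x

lemma powSlope_one_right (s : ℝ) : powSlope s 1 = s := by
  simp [powSlope, dslope_same]

lemma powSlope_of_ne {x : ℝ} (s : ℝ) (hx : x ≠ 1) : powSlope s x = (x ^ s - 1) / (x - 1) := by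
  simp [powSlope, dslope_of_ne _ hx, slope_def_field]

lemma powSlope_one_left (x : ℝ) : powSlope 1 x = 1 := by
  rcases eq_or_ne x 1 with rfl | hx
  · exact powSlope_one_right 1
  · rw [powSlope_of_ne 1 hx, Real.rpow_one, div_self (sub_ne_zero.2 hx)]

lemma continuous_powSlope {s : ℝ} (hs : 0 < s) : Continuous (powSlope s) := by
  rw [continuous_iff_continuousAt]
  intro x
  have hc : Continuous (fun y : ℝ => y ^ s) := Real.continuous_rpow_const hs.le
  rcases eq_or_ne x 1 with rfl | hx
  · exact continuousAt_dslope_same.2 (Real.differentiableAt_rpow_const_of_ne s one_ne_zero)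
  · exact (continuousAt_dslope_of_ne hx).2 hc.continuousAt

lemma powSlope_nonneg {s x : ℝ} (hs : 0 < s) (hx : x ∈ Set.Icc (0 : ℝ) 1) : 0 ≤ powSlope s x := by
  rcases eq_or_ne x 1 with rfl | hx1
  · rw [powSlope_one_right]; exact hs.le
  · rw [powSlope_of_ne s hx1]
    exact div_nonneg_of_nonpos (sub_nonpos.2 (Real.rpow_le_one hx.1 hx.2 hs.le))
      (sub_nonpos.2 hx.2)

lemma powSlope_le {s x : ℝ} (hs : 0 < s) (hx : x ∈ Set.Icc (0 : ℝ) 1) : powSlope s x ≤ 1 + s := by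
  rcases eq_or_ne x 1 with rfl | hx1
  · rw [powSlope_one_right]; linarith
  · have hlt : 0 < 1 - x := sub_pos.2 (lt_of_le_of_ne hx.2 hx1)
    rw [powSlope_of_ne s hx1, ← neg_div_neg_eq, neg_sub, neg_sub, div_le_iff₀ hlt]
    rcases le_total s 1 with h | h
    · have : x ^ (1 : ℝ) ≤ x ^ s := Real.rpow_le_rpow_of_exponent_ge' hx.1 hx.2 hs.le h
      rw [Real.rpow_one] at this
      nlinarith
    · have := one_add_mul_self_le_rpow_one_add (s := x - 1) (by linarith [hx.1]) h
      rw [add_sub_cancel] at this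
      nlinarith

lemma abs_powSlope_le {s x : ℝ} (hs : 0 < s) (hx : x ∈ Set.Icc (0 : ℝ) 1) :
    |powSlope s x| ≤ 1 + s := by
  rw [abs_of_nonneg (powSlope_nonneg hs hx)]
  exact powSlope_le hs hx

lemma continuousAt_powSlope_left {s x : ℝ} (hs : 0 < s) :
    ContinuousAt (fun u => powSlope u x) s := by
  rcases eq_or_ne x 1 with rfl | hx1
  · simpa only [powSlope_one_right] using continuousAt_id' s
  · simp only [powSlope_of_ne _ hx1]
    exact ((Real.continuousAt_const_rpow' hs.ne').sub continuousAt_const).div_const _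

lemma powSlope_pow_mul_geom_sum {N i : ℕ} (hN : 0 < N) {x : ℝ}
    (hx : x ∈ Set.Icc (0 : ℝ) 1) :
    powSlope ((i : ℝ) * (N : ℝ)⁻¹) (x ^ N) * ∑ a ∈ Finset.range N, x ^ a =
      ∑ a ∈ Finset.range i, x ^ a := by
  have hN0 : (N : ℝ) ≠ 0 := by exact_mod_cast hN.ne'
  rcases eq_or_ne x 1 with rfl | hx1
  · simp [powSlope_one_right, hN0]
  · have hxN : x ^ N ≠ 1 := (pow_lt_one₀ hx.1 (lt_of_le_of_ne hx.2 hx1) hN.ne').ne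
    have hp : (x ^ N) ^ ((i : ℝ) * (N : ℝ)⁻¹) = x ^ i := by
      rw [← Real.rpow_natCast x N, ← Real.rpow_mul hx.1, mul_comm (i : ℝ), ← mul_assoc,
        mul_inv_cancel₀ hN0, one_mul, Real.rpow_natCast]
    rw [powSlope_of_ne _ hxN, hp, geom_sum_eq hx1, geom_sum_eq hx1,
      div_mul_div_cancel₀ (sub_ne_zero.2 hxN)]

/-- Representation of `g` on a uniform grid by a measure on the square. -/
lemma exists_measure_grid {g : ℝ → ℝ → ℝ} (hbd : ∀ t : ℝ, 0 ≤ t → g t 0 = 0 ∧ g 0 t = 0)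
    {N : ℕ} (hN : 0 < N)
    (hcm : CompletelyMonotoneSeq
      (fun i j => mixedDiff g (N : ℝ)⁻¹ (N : ℝ)⁻¹ (i * (N : ℝ)⁻¹) (j * (N : ℝ)⁻¹))) :
    ∃ ρ : FiniteMeasure (I × I), ∀ i j : ℕ, 0 < i → 0 < j →
      ∫ x : I × I, powSlope (i * (N : ℝ)⁻¹) x.1 * powSlope (j * (N : ℝ)⁻¹) x.2
        ∂(ρ : Measure (I × I)) = g (i * (N : ℝ)⁻¹) (j * (N : ℝ)⁻¹) := by
  obtain ⟨μ, hμ⟩ := hcm.exists_measure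
  set w : I × I → NNReal := fun x => Real.toNNReal
    ((∑ a ∈ Finset.range N, (x.1 : ℝ) ^ a) * ∑ a ∈ Finset.range N, (x.2 : ℝ) ^ a) with hw
  have hwc : Continuous w := by fun_prop
  have hw0 (x : I × I) : (w x : ℝ) = (∑ a ∈ Finset.range N, (x.1 : ℝ) ^ a) *
      ∑ a ∈ Finset.range N, (x.2 : ℝ) ^ a := by
    rw [hw, Real.coe_toNNReal]
    have h1 := x.1.2.1
    have h2 := x.2.2.1
    positivity
  have hfin : IsFiniteMeasure ((μ : Measure (I × I)).withDensity fun x => (w x : ENNReal)) := by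
    refine isFiniteMeasure_withDensity ?_
    obtain ⟨C, hC⟩ := (isCompact_range hwc).bddAbove
    refine ((lintegral_mono fun x => ENNReal.coe_le_coe.2 (hC ⟨x, rfl⟩)).trans_lt ?_).ne
    rw [lintegral_const]
    exact ENNReal.mul_lt_top ENNReal.coe_lt_top (measure_lt_top _ _)
  let φ : I × I → I × I := fun x => (x.1 ^ N, x.2 ^ N)
  have hφ : Continuous φ := by fun_prop
  refine ⟨⟨((μ : Measure (I × I)).withDensity fun x => (w x : ENNReal)).map φ, inferInstance⟩,
    fun i j hi hj => ?_⟩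
  have hs {i : ℕ} (hi : 0 < i) : 0 < (i : ℝ) * (N : ℝ)⁻¹ := by positivity
  have hcont : Continuous (fun x : I × I =>
      powSlope (i * (N : ℝ)⁻¹) x.1 * powSlope (j * (N : ℝ)⁻¹) x.2) :=
    ((continuous_powSlope (hs hi)).comp (by fun_prop)).mul
      ((continuous_powSlope (hs hj)).comp (by fun_prop))
  rw [FiniteMeasure.toMeasure_mk, integral_map hφ.aemeasurable hcont.aestronglyMeasurable,
    integral_withDensity_eq_integral_smul hwc.measurable]
  have hpt (x : I × I) : w x • (powSlope (i * (N : ℝ)⁻¹) (φ x).1 *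
      powSlope (j * (N : ℝ)⁻¹) (φ x).2) =
      ∑ a ∈ Finset.range i, ∑ b ∈ Finset.range j, (x.1 : ℝ) ^ a * (x.2 : ℝ) ^ b := by
    rw [NNReal.smul_def, hw0, smul_eq_mul, ← Finset.sum_mul_sum,
      ← powSlope_pow_mul_geom_sum (i := i) hN x.1.2,
      ← powSlope_pow_mul_geom_sum (i := j) hN x.2.2]
    simp only [φ, Set.Icc.coe_pow]
    ring
  simp only [hpt]
  have hintegrable (a b : ℕ) : Integrable (fun x : I × I => (x.1 : ℝ) ^ a * (x.2 : ℝ) ^ b)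
      (μ : Measure (I × I)) :=
    Continuous.integrable_of_hasCompactSupport (by fun_prop) (HasCompactSupport.of_compactSpace _)
  rw [integral_finsetSum _ fun a _ => integrable_finsetSum _ fun b _ => hintegrable a b]
  simp only [integral_finsetSum _ fun b _ => hintegrable _ b, hμ]
  rw [sum_sum_mixedDiff, (hbd _ (hs hi).le).1, (hbd _ (hs hj).le).2, (hbd 0 le_rfl).1]
  ring

lemma exists_measure_dyadic {g : ℝ → ℝ → ℝ} (hbd : ∀ t : ℝ, 0 ≤ t → g t 0 = 0 ∧ g 0 t = 0)
    (hcm : ∀ h : ℝ, 0 < h → CompletelyMonotoneSeq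
      (fun i j => mixedDiff g h h (i * h) (j * h))) :
    ∃ ρ : FiniteMeasure (I × I), ∀ m i j : ℕ, 0 < i → 0 < j →
      ∫ x : I × I, powSlope (i * ((2 : ℝ) ^ m)⁻¹) x.1 * powSlope (j * ((2 : ℝ) ^ m)⁻¹) x.2
        ∂(ρ : Measure (I × I)) = g (i * ((2 : ℝ) ^ m)⁻¹) (j * ((2 : ℝ) ^ m)⁻¹) := by
  choose ρ hρ using fun n : ℕ => exists_measure_grid hbd (N := 2 ^ n) (by positivity)
    (hcm _ (by positivity))
  obtain ⟨ν, hν⟩ := exists_measure_of_mass_le ρ (g 1 1).toNNReal (fun n => by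
    have h := hρ n (2 ^ n) (2 ^ n) (by positivity) (by positivity)
    have h0 : ((2 ^ n : ℕ) : ℝ) ≠ 0 := by positivity
    rw [mul_inv_cancel₀ h0] at h
    simp only [powSlope_one_left, mul_one, integral_const, smul_eq_mul] at h
    rw [← h]
    exact (Real.toNNReal_coe (r := (ρ n).mass)).ge)
  refine ⟨ν, fun m i j hi hj => ?_⟩
  have hs {i : ℕ} (hi : 0 < i) : 0 < (i : ℝ) * ((2 : ℝ) ^ m)⁻¹ := by positivity
  refine hν _ (((continuous_powSlope (hs hi)).comp (by fun_prop)).mul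
    ((continuous_powSlope (hs hj)).comp (by fun_prop))) _ (tendsto_const_nhds.congr' ?_)
  filter_upwards [eventually_ge_atTop m] with n hn
  have he (i : ℕ) : (i : ℝ) * ((2 : ℝ) ^ m)⁻¹ = ((i * 2 ^ (n - m) : ℕ) : ℝ) *
      ((2 ^ n : ℕ) : ℝ)⁻¹ := by
    obtain ⟨k, rfl⟩ := Nat.exists_eq_add_of_le hn
    push_cast
    rw [Nat.add_sub_cancel_left, pow_add]
    field_simp
  rw [he i, he j, ← hρ n _ _ (by positivity) (by positivity)]
  rfl

lemma exists_dyadic_tendsto {s : ℝ} (hs : 0 < s) :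
    ∃ i : ℕ → ℕ, (∀ n, 0 < i n) ∧
      Tendsto (fun n => (i n : ℝ) * ((2 : ℝ) ^ n)⁻¹) atTop (𝓝 s) ∧
      ∀ n, (i n : ℝ) * ((2 : ℝ) ^ n)⁻¹ ≤ s + 1 := by
  have hb (n : ℕ) : s ≤ (⌈s * 2 ^ n⌉₊ : ℝ) * ((2 : ℝ) ^ n)⁻¹ ∧
      (⌈s * 2 ^ n⌉₊ : ℝ) * ((2 : ℝ) ^ n)⁻¹ ≤ s + ((1 / 2 : ℝ)) ^ n := by
    have h2 : (0 : ℝ) < 2 ^ n := by positivity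
    rw [← div_eq_mul_inv, le_div_iff₀ h2, div_le_iff₀ h2, add_mul, ← mul_pow]
    norm_num
    exact ⟨Nat.le_ceil _, (Nat.ceil_lt_add_one (by positivity)).le⟩
  refine ⟨fun n => ⌈s * 2 ^ n⌉₊, fun n => Nat.ceil_pos.2 (by positivity), ?_, fun n => ?_⟩
  · refine tendsto_of_tendsto_of_tendsto_of_le_of_le tendsto_const_nhds ?_ (fun n => (hb n).1)
      (fun n => (hb n).2)
    simpa using (tendsto_pow_atTop_nhds_zero_of_lt_one (by norm_num : (0 : ℝ) ≤ 1 / 2)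
      (by norm_num)).const_add s
  · exact (hb n).2.trans (by gcongr; exact pow_le_one₀ (by norm_num) (by norm_num))

/-- Representation of `g` on the open quadrant by a measure on the square. -/
lemma exists_measure_powSlope {g : ℝ → ℝ → ℝ}
    (hg : ContinuousOn (fun p : ℝ × ℝ => g p.1 p.2) (Set.Ici 0 ×ˢ Set.Ici 0))
    (hbd : ∀ t : ℝ, 0 ≤ t → g t 0 = 0 ∧ g 0 t = 0)
    (hcm : ∀ h : ℝ, 0 < h → CompletelyMonotoneSeq
      (fun i j => mixedDiff g h h (i * h) (j * h))) :
    ∃ ρ : FiniteMeasure (I × I), ∀ s t : ℝ, 0 < s → 0 < t →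
      ∫ x : I × I, powSlope s x.1 * powSlope t x.2 ∂(ρ : Measure (I × I)) = g s t := by
  obtain ⟨ρ, hρ⟩ := exists_measure_dyadic hbd hcm
  refine ⟨ρ, fun s t hs ht => ?_⟩
  obtain ⟨i, hi0, hi, hi1⟩ := exists_dyadic_tendsto hs
  obtain ⟨j, hj0, hj, hj1⟩ := exists_dyadic_tendsto ht
  have hp {i : ℕ → ℕ} (hi : ∀ n, 0 < i n) (n : ℕ) : 0 < (i n : ℝ) * ((2 : ℝ) ^ n)⁻¹ :=
    mul_pos (by exact_mod_cast hi n) (by positivity)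
  have h1 : Tendsto (fun n => g (i n * ((2 : ℝ) ^ n)⁻¹) (j n * ((2 : ℝ) ^ n)⁻¹)) atTop
      (𝓝 (g s t)) := by
    have := (hg (s, t) ⟨hs.le, ht.le⟩).tendsto
    refine this.comp (tendsto_nhdsWithin_iff.2 ⟨hi.prodMk_nhds hj, ?_⟩)
    exact Eventually.of_forall fun n => ⟨(hp hi0 n).le, (hp hj0 n).le⟩
  refine tendsto_nhds_unique ?_ h1
  simp only [← hρ _ _ _ (hi0 _) (hj0 _)]
  refine tendsto_integral_of_dominated_convergence (fun _ => (1 + (s + 1)) * (1 + (t + 1)))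
    (fun n => Continuous.aestronglyMeasurable
      (((continuous_powSlope (hp hi0 n)).comp (by fun_prop)).mul
        ((continuous_powSlope (hp hj0 n)).comp (by fun_prop)))) (integrable_const _)
    (fun n => Eventually.of_forall fun x => ?_) (Eventually.of_forall fun x => ?_)
  · rw [Real.norm_eq_abs, abs_mul]
    have e1 := abs_powSlope_le (hp hi0 n) x.1.2
    have e2 := abs_powSlope_le (hp hj0 n) x.2.2
    have := hi1 n
    have := hj1 n
    exact mul_le_mul (by linarith) (by linarith) (abs_nonneg _) (by linarith)
  · exact ((continuousAt_powSlope_left hs).tendsto.comp hi).mul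
      ((continuousAt_powSlope_left ht).tendsto.comp hj)

end MomentProblem

section Bernstein

open Filter Topology Polynomial

lemma G10_of_ne {r : NNReal} (hr : r ≠ 0) (s : ℝ) :
    G10 r s = (1 - Real.exp (-(r : ℝ) * s)) / (r : ℝ) := if_neg hr

lemma G10_zero_left (s : ℝ) : G10 0 s = s := if_pos rfl

lemma G10_zero_right (r : NNReal) : G10 r 0 = 0 := by
  simp [G10]

lemma G10_eq_dslope (r : NNReal) (s : ℝ) :
    G10 r s = dslope (fun x : ℝ => 1 - Real.exp (-x * s)) 0 r := by
  rcases eq_or_ne r 0 with rfl | hr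
  · have h : HasDerivAt (fun x : ℝ => 1 - Real.exp (-x * s)) s 0 := by
      have := ((((hasDerivAt_id (0 : ℝ)).neg).mul_const s).exp).const_sub 1
      simpa using this
    rw [G10_zero_left, NNReal.coe_zero, dslope_same, h.deriv]
  · rw [G10_of_ne hr, dslope_of_ne _ (by exact_mod_cast hr), slope_def_field]
    simp

lemma continuous_G10 (s : ℝ) : Continuous (fun r : NNReal => G10 r s) := by
  simp only [G10_eq_dslope]
  have h : Continuous (dslope (fun x : ℝ => 1 - Real.exp (-x * s)) 0) := by
    have hd : Differentiable ℝ (fun x : ℝ => 1 - Real.exp (-x * s)) := by fun_prop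
    rw [continuous_iff_continuousAt]
    intro x
    rcases eq_or_ne x 0 with rfl | hx
    · exact continuousAt_dslope_same.2 (hd 0)
    · exact (continuousAt_dslope_of_ne hx).2 hd.continuous.continuousAt
  exact h.comp NNReal.continuous_coe

lemma G10_nonneg (r : NNReal) {s : ℝ} (hs : 0 ≤ s) : 0 ≤ G10 r s := by
  rcases eq_or_ne r 0 with rfl | hr
  · rwa [G10_zero_left]
  · rw [G10_of_ne hr]
    refine div_nonneg (sub_nonneg.2 (Real.exp_le_one_iff.2 ?_)) r.2
    rw [neg_mul]
    exact neg_nonpos.2 (mul_nonneg r.2 hs)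

lemma G10_mul_le (r : NNReal) (s : ℝ) : G10 r s * (1 + r) ≤ s + 1 := by
  rcases eq_or_ne r 0 with rfl | hr
  · simp [G10_zero_left]
  · have hr0 : (0 : ℝ) < r := by exact_mod_cast pos_iff_ne_zero.2 hr
    rw [G10_of_ne hr, div_mul_eq_mul_div, div_le_iff₀ hr0]
    have h1 := Real.add_one_le_exp (-(r : ℝ) * s)
    have h2 := Real.exp_pos (-(r : ℝ) * s)
    nlinarith

lemma abs_G10_mul_le (r : NNReal) {s : ℝ} (hs : 0 ≤ s) : |G10 r s * (1 + r)| ≤ s + 1 := by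
  rw [abs_of_nonneg (mul_nonneg (G10_nonneg r hs) (by positivity))]
  exact G10_mul_le r s

lemma one_le_G10_one_mul (r : NNReal) : 1 ≤ G10 r 1 * (1 + r) := by
  rcases eq_or_ne r 0 with rfl | hr
  · simp [G10_zero_left]
  · have hr0 : (0 : ℝ) < r := by exact_mod_cast pos_iff_ne_zero.2 hr
    rw [G10_of_ne hr, div_mul_eq_mul_div, le_div_iff₀ hr0]
    have h1 := Real.add_one_le_exp (r : ℝ)
    have h2 : Real.exp (-(r : ℝ) * 1) * Real.exp r = 1 := by
      rw [← Real.exp_add]; simp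
    have h3 := Real.exp_pos (-(r : ℝ) * 1)
    nlinarith

lemma powSlope_eq_G10_div {s x : ℝ} (hx0 : 0 < x) (hx1 : x ≤ 1) :
    powSlope s x = G10 (Real.toNNReal (-Real.log x)) s / G10 (Real.toNNReal (-Real.log x)) 1 := by
  have hl : 0 ≤ -Real.log x := neg_nonneg.2 (Real.log_nonpos hx0.le hx1)
  rcases eq_or_ne x 1 with rfl | hne
  · simp [powSlope_one_right, G10_zero_left]
  · have hlog : -Real.log x ≠ 0 := neg_ne_zero.2 (Real.log_ne_zero_of_pos_of_ne_one hx0 hne)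
    have hr : Real.toNNReal (-Real.log x) ≠ 0 := by
      rw [Ne, Real.toNNReal_eq_zero, not_le]
      exact lt_of_le_of_ne hl hlog.symm
    rw [powSlope_of_ne s hne, G10_of_ne hr, G10_of_ne hr, Real.coe_toNNReal _ hl,
      div_div_div_cancel_right₀ hlog, neg_neg, mul_one, Real.exp_log hx0,
      ← Real.rpow_def_of_pos hx0, ← neg_div_neg_eq, neg_sub, neg_sub]

lemma integrable_G10_kernel {σ : Measure (NNReal × NNReal)} [IsFiniteMeasure σ] {s t : ℝ}
    (hs : 0 ≤ s) (ht : 0 ≤ t) :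
    Integrable (fun r : NNReal × NNReal =>
      G10 r.1 s * G10 r.2 t * (1 + (r.1 : ℝ)) * (1 + (r.2 : ℝ))) σ := by
  have h1 : Continuous fun r : NNReal × NNReal => G10 r.1 s :=
    (continuous_G10 s).comp continuous_fst
  have h2 : Continuous fun r : NNReal × NNReal => G10 r.2 t :=
    (continuous_G10 t).comp continuous_snd
  refine Integrable.of_bound (C := (s + 1) * (t + 1))
    (Continuous.aestronglyMeasurable (by fun_prop)) (Eventually.of_forall fun r => ?_)
  have : G10 r.1 s * G10 r.2 t * (1 + (r.1 : ℝ)) * (1 + (r.2 : ℝ))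
      = (G10 r.1 s * (1 + r.1)) * (G10 r.2 t * (1 + r.2)) := by ring
  rw [this, Real.norm_eq_abs, abs_mul]
  exact mul_le_mul (abs_G10_mul_le _ hs) (abs_G10_mul_le _ ht) (abs_nonneg _) (by linarith)

lemma tendsto_powSlope_inv_nat {x : ℝ} (hx : 0 ≤ x) :
    Tendsto (fun n : ℕ => powSlope ((n : ℝ) + 1)⁻¹ x) atTop (𝓝 (if x = 0 then 1 else 0)) := by
  have hn : Tendsto (fun n : ℕ => ((n : ℝ) + 1)⁻¹) atTop (𝓝 0) :=
    tendsto_inv_atTop_zero.comp (tendsto_atTop_add_const_right _ _ tendsto_natCast_atTop_atTop)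
  split_ifs with h
  · subst h
    refine tendsto_const_nhds.congr fun n => ?_
    rw [powSlope_of_ne _ zero_ne_one, Real.zero_rpow (by positivity)]
    norm_num
  · rcases eq_or_ne x 1 with rfl | h1
    · simpa only [powSlope_one_right] using hn
    · simp only [powSlope_of_ne _ h1]
      have := ((Real.continuousAt_const_rpow h).tendsto.comp hn).sub_const 1 |>.div_const (x - 1)
      simpa using this

lemma ae_pos_of_integral_powSlope_tendsto {ρ : FiniteMeasure (unitInterval × unitInterval)}
    {π : unitInterval × unitInterval → unitInterval} (hπ : Continuous π) {φ : ℝ → ℝ}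
    (hρ : ∀ s, 0 < s → ∫ x, powSlope s (π x) ∂(ρ : Measure (unitInterval × unitInterval)) = φ s)
    (hφ : Tendsto φ (𝓝[>] 0) (𝓝 0)) :
    ∀ᵐ x ∂(ρ : Measure (unitInterval × unitInterval)), 0 < (π x : ℝ) := by
  have hn : Tendsto (fun n : ℕ => ((n : ℝ) + 1)⁻¹) atTop (𝓝[>] 0) :=
    tendsto_nhdsWithin_iff.2 ⟨tendsto_inv_atTop_zero.comp
      (tendsto_atTop_add_const_right _ _ tendsto_natCast_atTop_atTop),
      Eventually.of_forall fun n => by simp only [Set.mem_Ioi]; positivity⟩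
  have hS : MeasurableSet {x : unitInterval × unitInterval | (π x : ℝ) = 0} :=
    (isClosed_singleton.preimage (continuous_subtype_val.comp hπ)).measurableSet
  have hlim : Tendsto (fun n : ℕ => ∫ x, powSlope ((n : ℝ) + 1)⁻¹ (π x)
      ∂(ρ : Measure (unitInterval × unitInterval))) atTop
      (𝓝 (∫ x, (if (π x : ℝ) = 0 then (1 : ℝ) else 0)
        ∂(ρ : Measure (unitInterval × unitInterval)))) := by
    refine tendsto_integral_of_dominated_convergence (fun _ => 2)
      (fun n => Continuous.aestronglyMeasurable
        ((continuous_powSlope (by positivity)).comp (continuous_subtype_val.comp hπ)))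
      (integrable_const _) (fun n => Eventually.of_forall fun x => ?_)
      (Eventually.of_forall fun x => tendsto_powSlope_inv_nat (π x).2.1)
    have h1 : ((n : ℝ) + 1)⁻¹ ≤ 1 := inv_le_one_of_one_le₀ (by simp)
    have h2 := abs_powSlope_le (s := ((n : ℝ) + 1)⁻¹) (by positivity) (π x).2
    rw [Real.norm_eq_abs]
    linarith
  have h0 := tendsto_nhds_unique hlim ((hφ.comp hn).congr fun n => (hρ _ (by positivity)).symm)
  have hind : (fun x => if (π x : ℝ) = 0 then (1 : ℝ) else 0) =
      Set.indicator {x : unitInterval × unitInterval | (π x : ℝ) = 0} 1 := by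
    ext x
    simp [Set.indicator_apply]
  rw [hind, integral_indicator_one hS, measureReal_eq_zero_iff] at h0
  rw [ae_iff]
  refine measure_mono_null (fun x hx => ?_) h0
  exact le_antisymm (not_lt.1 hx) (π x).2.1

theorem exists_measure_G10 {g : ℝ → ℝ → ℝ}
    (hg : ContinuousOn (fun p : ℝ × ℝ => g p.1 p.2) (Set.Ici 0 ×ˢ Set.Ici 0))
    (hbd : ∀ t : ℝ, 0 ≤ t → g t 0 = 0 ∧ g 0 t = 0)
    (hcm : ∀ h : ℝ, 0 < h → CompletelyMonotoneSeq
      (fun i j => mixedDiff g h h (i * h) (j * h))) :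
    ∃ σ : Measure (NNReal × NNReal), IsFiniteMeasure σ ∧ ∀ t₁ t₂ : ℝ, 0 ≤ t₁ → 0 ≤ t₂ →
      g t₁ t₂ = ∫ r, G10 r.1 t₁ * G10 r.2 t₂ * (1 + (r.1 : ℝ)) * (1 + (r.2 : ℝ)) ∂σ := by
  obtain ⟨ρ, hρ⟩ := exists_measure_powSlope hg hbd hcm
  have hpos1 : ∀ᵐ x ∂(ρ : Measure (unitInterval × unitInterval)), 0 < (x.1 : ℝ) := by
    refine ae_pos_of_integral_powSlope_tendsto (φ := fun s => g s 1) continuous_fst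
      (fun s hs => by simpa only [powSlope_one_left, mul_one] using hρ s 1 hs one_pos) ?_
    have h := (hg (0, 1) (by simp)).tendsto
    simp only [(hbd 1 zero_le_one).2] at h
    refine h.comp (g := fun p : ℝ × ℝ => g p.1 p.2) 
      (f := fun s : ℝ => (s, (1 : ℝ))) (tendsto_nhdsWithin_iff.2 ⟨?_, ?_⟩)
    · exact (tendsto_id.mono_left nhdsWithin_le_nhds).prodMk_nhds tendsto_const_nhds
    · filter_upwards [self_mem_nhdsWithin] with s hs
      simpa using le_of_lt (Set.mem_Ioi.1 hs)
  have hpos2 : ∀ᵐ x ∂(ρ : Measure (unitInterval × unitInterval)), 0 < (x.2 : ℝ) := by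
    refine ae_pos_of_integral_powSlope_tendsto (φ := fun s => g 1 s) continuous_snd
      (fun s hs => by simpa only [powSlope_one_left, one_mul] using hρ 1 s one_pos hs) ?_
    have h := (hg (1, 0) (by simp)).tendsto
    simp only [(hbd 1 zero_le_one).1] at h
    refine h.comp (g := fun p : ℝ × ℝ => g p.1 p.2) 
      (f := fun s : ℝ => ((1 : ℝ), s)) (tendsto_nhdsWithin_iff.2 ⟨?_, ?_⟩)
    · exact tendsto_const_nhds.prodMk_nhds (tendsto_id.mono_left nhdsWithin_le_nhds)
    · filter_upwards [self_mem_nhdsWithin] with s hs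
      simpa using le_of_lt (Set.mem_Ioi.1 hs)
  let ψ : unitInterval × unitInterval → NNReal × NNReal := fun x =>
    (Real.toNNReal (-Real.log x.1), Real.toNNReal (-Real.log x.2))
  have hψ : Measurable ψ := by fun_prop
  have hG : Continuous fun r : NNReal × NNReal =>
      G10 r.1 1 * (1 + (r.1 : ℝ)) * (G10 r.2 1 * (1 + (r.2 : ℝ))) := by
    have h1 : Continuous fun r : NNReal × NNReal => G10 r.1 1 :=
      (continuous_G10 1).comp continuous_fst
    have h2 : Continuous fun r : NNReal × NNReal => G10 r.2 1 :=
      (continuous_G10 1).comp continuous_snd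
    fun_prop
  have hG1 (r : NNReal × NNReal) :
      1 ≤ G10 r.1 1 * (1 + (r.1 : ℝ)) * (G10 r.2 1 * (1 + (r.2 : ℝ))) :=
    one_le_mul_of_one_le_of_one_le (one_le_G10_one_mul _) (one_le_G10_one_mul _)
  let w : NNReal × NNReal → NNReal := fun r => Real.toNNReal
    (G10 r.1 1 * (1 + (r.1 : ℝ)) * (G10 r.2 1 * (1 + (r.2 : ℝ))))⁻¹
  have hwm : Measurable w := (hG.measurable.inv).real_toNNReal
  have hw (r : NNReal × NNReal) :
      (w r : ℝ) = (G10 r.1 1 * (1 + (r.1 : ℝ)) * (G10 r.2 1 * (1 + (r.2 : ℝ))))⁻¹ :=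
    Real.coe_toNNReal _ (inv_nonneg.2 (zero_le_one.trans (hG1 r)))
  have hw1 (r : NNReal × NNReal) : w r ≤ 1 := by
    rw [← NNReal.coe_le_coe, hw, NNReal.coe_one]
    exact inv_le_one_of_one_le₀ (hG1 r)
  refine ⟨((ρ : Measure (unitInterval × unitInterval)).map ψ).withDensity fun r =>
    (w r : ENNReal), ?_, fun s t hs ht => ?_⟩
  · refine isFiniteMeasure_withDensity
      ((lintegral_mono fun r => ENNReal.coe_le_coe.2 (hw1 r)).trans_lt ?_).ne
    rw [lintegral_const]
    exact ENNReal.mul_lt_top ENNReal.coe_lt_top (measure_lt_top _ _)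
  · rcases hs.eq_or_lt with rfl | hs
    · simp [G10_zero_right, (hbd t ht).2]
    rcases ht.eq_or_lt with rfl | ht
    · simp [G10_zero_right, (hbd s hs.le).1]
    have h1 : Continuous fun r : NNReal × NNReal => G10 r.1 s :=
      (continuous_G10 s).comp continuous_fst
    have h2 : Continuous fun r : NNReal × NNReal => G10 r.2 t :=
      (continuous_G10 t).comp continuous_snd
    have hF : Measurable fun r : NNReal × NNReal =>
        w r • (G10 r.1 s * G10 r.2 t * (1 + (r.1 : ℝ)) * (1 + (r.2 : ℝ))) :=
      hwm.smul (Continuous.measurable (by fun_prop))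
    rw [← hρ s t hs ht, integral_withDensity_eq_integral_smul hwm,
      integral_map hψ.aemeasurable hF.aestronglyMeasurable]
    refine integral_congr_ae ?_
    filter_upwards [hpos1, hpos2] with x hx1 hx2
    have hne (r : NNReal) : G10 r 1 ≠ 0 := fun h => by
      have := one_le_G10_one_mul r
      rw [h, zero_mul] at this
      exact absurd this (by norm_num)
    have hne' (r : NNReal) : (1 + (r : ℝ)) ≠ 0 := by positivity
    rw [powSlope_eq_G10_div hx1 x.1.2.2, powSlope_eq_G10_div hx2 x.2.2.2, NNReal.smul_def, hw,
      smul_eq_mul]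
    have := hne (ψ x).1
    have := hne (ψ x).2
    have := hne' (ψ x).1
    have := hne' (ψ x).2
    change G10 (ψ x).1 s / G10 (ψ x).1 1 * (G10 (ψ x).2 t / G10 (ψ x).2 1) = _
    field_simp

lemma momentForm_one_sub_X_mul_left (a : ℕ → ℕ → ℝ) (p q : ℝ[X]) :
    momentForm a ((1 - X) * p) q = momentForm (fun i j => a i j - a (i + 1) j) p q := by
  have h : (momentForm a) ∘ₗ (LinearMap.mulLeft ℝ (1 - X)) =
      momentForm (fun i j => a i j - a (i + 1) j) := by
    refine (Polynomial.basisMonomials ℝ).ext fun i => (Polynomial.basisMonomials ℝ).ext fun j => ?_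
    simp only [Polynomial.coe_basisMonomials, Polynomial.monomial_one_right_eq_X_pow,
      LinearMap.comp_apply, LinearMap.mulLeft_apply, sub_mul, one_mul, ← pow_succ', map_sub,
      LinearMap.sub_apply, momentForm_X_pow]
  exact LinearMap.congr_fun₂ h p q

lemma momentForm_one_sub_X_mul_right (a : ℕ → ℕ → ℝ) (p q : ℝ[X]) :
    momentForm a p ((1 - X) * q) = momentForm (fun i j => a i j - a i (j + 1)) p q := by
  have h : (momentForm a).compl₂ (LinearMap.mulLeft ℝ (1 - X)) =
      momentForm (fun i j => a i j - a i (j + 1)) := by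
    refine (Polynomial.basisMonomials ℝ).ext fun i => (Polynomial.basisMonomials ℝ).ext fun j => ?_
    simp only [Polynomial.coe_basisMonomials, Polynomial.monomial_one_right_eq_X_pow,
      LinearMap.compl₂_apply, LinearMap.mulLeft_apply, sub_mul, one_mul, ← pow_succ', map_sub,
      momentForm_X_pow]
  exact LinearMap.congr_fun₂ h p q

/-- A class of functions with nonnegative rectangular increments which is stable under the
operators `g ↦ g - g(· + h, ·)` and `g ↦ g - g(·, · + h)` consists of functions whose
rectangular increments along the grid of mesh `h` are completely monotone. -/
lemma completelyMonotoneSeq_mixedDiff {P : (ℝ → ℝ → ℝ) → Prop} {h : ℝ} (hh : 0 < h)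
    (h1 : ∀ g, P g → P (fun s t => g s t - g (s + h) t))
    (h2 : ∀ g, P g → P (fun s t => g s t - g s (t + h)))
    (h3 : ∀ g, P g → ∀ s t, 0 ≤ s → 0 ≤ t → 0 ≤ mixedDiff g h h s t)
    {g : ℝ → ℝ → ℝ} (hg : P g) :
    CompletelyMonotoneSeq (fun i j => mixedDiff g h h (i * h) (j * h)) := by
  intro p q i j
  induction p generalizing g with
  | zero =>
    induction q generalizing g with
    | zero =>
      simp only [pow_zero, mul_one, momentForm_X_pow]
      exact h3 g hg _ _ (by positivity) (by positivity)
    | succ q ih =>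
      rw [pow_succ' _ q, mul_left_comm, momentForm_one_sub_X_mul_right]
      convert! ih (h2 g hg) using 4
      funext a b
      simp only [mixedDiff, Nat.cast_add, Nat.cast_one, add_mul, one_mul]
      ring
  | succ p ih =>
    rw [pow_succ' _ p, mul_left_comm, momentForm_one_sub_X_mul_left]
    convert! ih (h1 g hg) using 4
    funext a b
    simp only [mixedDiff, Nat.cast_add, Nat.cast_one, add_mul, one_mul]
    ring

/-- The radial kernel attached to `g` is positive definite independent on all pairs of
finite-dimensional inner product spaces, with configurations indexed by arbitrary finite types. -/
def RadialPDI (g : ℝ → ℝ → ℝ) : Prop :=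
  ∀ (A B : Type) [Fintype A] [Fintype B] (E F : Type)
    [NormedAddCommGroup E] [InnerProductSpace ℝ E] [FiniteDimensional ℝ E]
    [NormedAddCommGroup F] [InnerProductSpace ℝ F] [FiniteDimensional ℝ F]
    (x : A → E) (y : B → F) (c : A → B → ℝ),
    (∀ k, ∑ i, c i k = 0) → (∀ i, ∑ k, c i k = 0) →
    0 ≤ ∑ i, ∑ j, ∑ k, ∑ l, c i k * c j l * g (‖x i - x j‖ ^ 2) (‖y k - y l‖ ^ 2)

lemma radialPDI_of_isPDI {g : ℝ → ℝ → ℝ}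
    (h : ∀ d d' : ℕ,
      IsPDI (fun p q : EuclideanSpace ℝ (Fin d) × EuclideanSpace ℝ (Fin d') =>
        g (‖p.1 - q.1‖ ^ 2) (‖p.2 - q.2‖ ^ 2))) : RadialPDI g := by
  intro A B _ _ E F _ _ _ _ _ _ x y c hc1 hc2
  let eA := (Fintype.equivFin A).symm
  let eB := (Fintype.equivFin B).symm
  have := h _ _ _ _ (fun i => (stdOrthonormalBasis ℝ E).repr (x (eA i)))
    (fun k => (stdOrthonormalBasis ℝ F).repr (y (eB k))) (fun i k => c (eA i) (eB k))
    (fun k => (eA.sum_comp fun i => c i (eB k)).trans (hc1 _))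
    (fun i => (eB.sum_comp fun k => c (eA i) k).trans (hc2 _))
  simp only [← map_sub, LinearIsometryEquiv.norm_map] at this
  refine this.trans_eq ?_
  rw [← eA.sum_comp]
  refine Finset.sum_congr rfl fun i _ => ?_
  rw [← eA.sum_comp]
  refine Finset.sum_congr rfl fun j _ => ?_
  rw [← eB.sum_comp]
  refine Finset.sum_congr rfl fun k _ => ?_
  rw [← eB.sum_comp]

namespace RadialPDI

lemma swap {g : ℝ → ℝ → ℝ} (hg : RadialPDI g) : RadialPDI (fun s t => g t s) := by
  intro A B _ _ E F _ _ _ _ _ _ x y c hc1 hc2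
  refine (hg B A F E y x (fun k i => c i k) hc2 hc1).trans_eq ?_
  calc _ = ∑ k, ∑ i, ∑ l, ∑ j, c i k * c j l * g (‖y k - y l‖ ^ 2) (‖x i - x j‖ ^ 2) :=
        Finset.sum_congr rfl fun k _ => Finset.sum_comm
    _ = ∑ i, ∑ k, ∑ l, ∑ j, c i k * c j l * g (‖y k - y l‖ ^ 2) (‖x i - x j‖ ^ 2) :=
        Finset.sum_comm
    _ = ∑ i, ∑ k, ∑ j, ∑ l, c i k * c j l * g (‖y k - y l‖ ^ 2) (‖x i - x j‖ ^ 2) :=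
        Finset.sum_congr rfl fun i _ => Finset.sum_congr rfl fun k _ => Finset.sum_comm
    _ = _ := Finset.sum_congr rfl fun i _ => Finset.sum_comm

lemma augment {g : ℝ → ℝ → ℝ} (hg : RadialPDI g) {D H : Type} [Fintype D]
    [NormedAddCommGroup H] [InnerProductSpace ℝ H] [FiniteDimensional ℝ H]
    (z : D → H) (w : D → ℝ) :
    RadialPDI (fun s t => ∑ a, ∑ b, w a * w b * g (s + ‖z a - z b‖ ^ 2) t) := by
  intro A B _ _ E F _ _ _ _ _ _ x y c hc1 hc2
  have := hg (A × D) B (WithLp 2 (E × H)) F (fun p => WithLp.toLp 2 (x p.1, z p.2)) y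
    (fun p k => c p.1 k * w p.2)
    (fun k => by
      simp only [Fintype.sum_prod_type]
      rw [← Fintype.sum_mul_sum, hc1 k, zero_mul])
    (fun p => by rw [← Finset.sum_mul, hc2 p.1, zero_mul])
  simp only [Fintype.sum_prod_type, ← WithLp.toLp_sub, WithLp.prod_norm_sq_eq_of_L2,
    Prod.mk_sub_mk] at this
  refine this.trans_eq (Finset.sum_congr rfl fun i _ => ?_)
  rw [Finset.sum_comm]
  refine Finset.sum_congr rfl fun j _ => ?_
  calc _ = ∑ a, ∑ k, ∑ b, ∑ l, c i k * w a * (c j l * w b) *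
        g (‖x i - x j‖ ^ 2 + ‖z a - z b‖ ^ 2) (‖y k - y l‖ ^ 2) :=
        Finset.sum_congr rfl fun a _ => Finset.sum_comm
    _ = ∑ k, ∑ a, ∑ b, ∑ l, c i k * w a * (c j l * w b) *
        g (‖x i - x j‖ ^ 2 + ‖z a - z b‖ ^ 2) (‖y k - y l‖ ^ 2) := Finset.sum_comm
    _ = ∑ k, ∑ a, ∑ l, ∑ b, c i k * w a * (c j l * w b) *
        g (‖x i - x j‖ ^ 2 + ‖z a - z b‖ ^ 2) (‖y k - y l‖ ^ 2) :=
        Finset.sum_congr rfl fun k _ => Finset.sum_congr rfl fun a _ => Finset.sum_comm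
    _ = ∑ k, ∑ l, ∑ a, ∑ b, c i k * w a * (c j l * w b) *
        g (‖x i - x j‖ ^ 2 + ‖z a - z b‖ ^ 2) (‖y k - y l‖ ^ 2) :=
        Finset.sum_congr rfl fun k _ => Finset.sum_comm
    _ = _ := by
        refine Finset.sum_congr rfl fun k _ => Finset.sum_congr rfl fun l _ => ?_
        simp only [Finset.mul_sum]
        refine Finset.sum_congr rfl fun a _ => Finset.sum_congr rfl fun b _ => ?_
        ring

lemma of_const_mul {g : ℝ → ℝ → ℝ} {C : ℝ} (hC : 0 < C)
    (hg : RadialPDI (fun s t => C * g s t)) : RadialPDI g := by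
  intro A B _ _ E F _ _ _ _ _ _ x y c hc1 hc2
  have := hg A B E F x y c hc1 hc2
  simp only [mul_left_comm _ C, ← Finset.mul_sum] at this
  exact nonneg_of_mul_nonneg_right this hC

lemma sub_shift_left {g : ℝ → ℝ → ℝ} (hg : RadialPDI g) {h : ℝ} (hh : 0 ≤ h) :
    RadialPDI (fun s t => g s t - g (s + h) t) := by
  refine of_const_mul two_pos ?_
  convert! hg.augment (D := Fin 2) ![0, √h] ![1, -1] using 3 with s t
  simp [Fin.sum_univ_two, Real.sq_sqrt hh]
  ring

lemma sub_shift_right {g : ℝ → ℝ → ℝ} (hg : RadialPDI g) {h : ℝ} (hh : 0 ≤ h) :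
    RadialPDI (fun s t => g s t - g s (t + h)) :=
  (hg.swap.sub_shift_left hh).swap

lemma shift_left {g : ℝ → ℝ → ℝ} (hg : RadialPDI g) {h : ℝ} (hh : 0 ≤ h) :
    RadialPDI (fun s t => g (s + h) t) := by
  have key (n : ℕ) : RadialPDI (fun s t => g s t + n * g (s + h) t) := by
    refine of_const_mul (C := n + 1) (by positivity) ?_
    convert! hg.augment (D := Fin (n + 1)) (H := EuclideanSpace ℝ (Fin (n + 1)))
      (fun a => EuclideanSpace.single a √(h / 2)) (fun _ => 1) using 3 with s t
    have hn (a b : Fin (n + 1)) : g (s + ‖EuclideanSpace.single a √(h / 2) -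
        EuclideanSpace.single b √(h / 2)‖ ^ 2) t = if b = a then g s t else g (s + h) t := by
      split_ifs with hab
      · simp [hab]
      · have : ‖EuclideanSpace.single a √(h / 2) - EuclideanSpace.single b √(h / 2)‖ ^ 2 = h := by
          rw [@norm_sub_sq ℝ]
          simp [EuclideanSpace.inner_single_left, Ne.symm hab, hh,
            abs_of_nonneg (Real.sqrt_nonneg _)]
          rw [div_pow, Real.sq_sqrt hh, Real.sq_sqrt (by norm_num)]
          ring
        rw [this]
    simp only [hn, one_mul]
    simp only [Finset.sum_ite, Finset.sum_const, Finset.filter_eq', Finset.filter_ne',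
      Finset.mem_univ, if_true, Finset.card_singleton, Finset.card_erase_of_mem, Finset.card_univ,
      Fintype.card_fin]
    simp
    ring
  intro A B _ _ E F _ _ _ _ _ _ x y c hc1 hc2
  have h1 (n : ℕ) := key n A B E F x y c hc1 hc2
  simp only [mul_add, Finset.sum_add_distrib, mul_left_comm _ (Nat.cast _ : ℝ),
    ← Finset.mul_sum] at h1
  by_contra! hneg
  obtain ⟨n, hn⟩ := exists_nat_gt
    ((∑ i, ∑ j, ∑ k, ∑ l, c i k * c j l * g (‖x i - x j‖ ^ 2) (‖y k - y l‖ ^ 2)) /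
      -(∑ i, ∑ j, ∑ k, ∑ l, c i k * c j l * g (‖x i - x j‖ ^ 2 + h) (‖y k - y l‖ ^ 2)))
  rw [div_lt_iff₀ (neg_pos.2 hneg)] at hn
  have := h1 n
  linarith

lemma shift_right {g : ℝ → ℝ → ℝ} (hg : RadialPDI g) {h : ℝ} (hh : 0 ≤ h) :
    RadialPDI (fun s t => g s (t + h)) :=
  (hg.swap.shift_left hh).swap

lemma mixedDiff_nonneg {g : ℝ → ℝ → ℝ} (hg : RadialPDI g) {h k s t : ℝ} (hh : 0 ≤ h)
    (hk : 0 ≤ k) (hs : 0 ≤ s) (ht : 0 ≤ t) : 0 ≤ mixedDiff g h k s t := by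
  have := ((hg.shift_left hs).shift_right ht) (Fin 2) (Fin 2) ℝ ℝ ![0, √h] ![0, √k]
    ![![1, -1], ![-1, 1]] (by simp [Fin.forall_fin_two]) (by simp [Fin.forall_fin_two])
  simp [Fin.sum_univ_two, Real.sq_sqrt hh, Real.sq_sqrt hk] at this
  rw [mixedDiff, add_comm s h, add_comm t k]
  linarith

lemma completelyMonotoneSeq {g : ℝ → ℝ → ℝ} (hg : RadialPDI g) {h : ℝ} (hh : 0 < h) :
    CompletelyMonotoneSeq (fun i j => mixedDiff g h h (i * h) (j * h)) :=
  completelyMonotoneSeq_mixedDiff hh (fun _ hg => hg.sub_shift_left hh.le)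
    (fun _ hg => hg.sub_shift_right hh.le)
    (fun _ hg _ _ hs ht => hg.mixedDiff_nonneg hh.le hh.le hs ht) hg

end RadialPDI

lemma sum_inner_pow_nonneg {ι E : Type*} [Fintype ι] [NormedAddCommGroup E]
    [InnerProductSpace ℝ E] (z : ι → E) (c : ι → ℝ) (n : ℕ) :
    0 ≤ ∑ a, ∑ b, c a * c b * inner ℝ (z a) (z b) ^ n := by
  have h : (Matrix.of fun a b => inner ℝ (z a) (z b) ^ n).PosSemidef := by
    induction n with
    | zero => simpa [Matrix.gram] using Matrix.posSemidef_gram ℝ (fun _ : ι => (1 : ℝ))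
    | succ n ih =>
      simp only [pow_succ]
      exact ih.hadamard (Matrix.posSemidef_gram ℝ z)
  refine (h.dotProduct_mulVec_nonneg c).trans_eq ?_
  simp only [dotProduct, Matrix.mulVec, Pi.star_apply, star_trivial, Matrix.of_apply,
    Finset.mul_sum]
  refine Finset.sum_congr rfl fun a _ => Finset.sum_congr rfl fun b _ => ?_
  ring

/-- The Gaussian kernel on a real inner product space is positive definite. -/
lemma sum_exp_neg_norm_sq_nonneg {ι E : Type*} [Fintype ι] [NormedAddCommGroup E]
    [InnerProductSpace ℝ E] (z : ι → E) (c : ι → ℝ) :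
    0 ≤ ∑ a, ∑ b, c a * c b * Real.exp (-‖z a - z b‖ ^ 2) := by
  have hexp (x : ℝ) : HasSum (fun n : ℕ => x ^ n / n.factorial) (Real.exp x) := by
    rw [Real.exp_eq_exp_ℝ]
    exact NormedSpace.expSeries_div_hasSum_exp x
  let w : ι → ℝ := fun a => c a * Real.exp (-‖z a‖ ^ 2)
  have hsum : HasSum (fun n : ℕ => ∑ a, ∑ b, w a * w b *
      ((2 * inner ℝ (z a) (z b)) ^ n / n.factorial))
      (∑ a, ∑ b, w a * w b * Real.exp (2 * inner ℝ (z a) (z b))) :=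
    hasSum_sum fun a _ => hasSum_sum fun b _ => (hexp _).mul_left _
  have hw : ∑ a, ∑ b, c a * c b * Real.exp (-‖z a - z b‖ ^ 2) =
      ∑ a, ∑ b, w a * w b * Real.exp (2 * inner ℝ (z a) (z b)) := by
    refine Finset.sum_congr rfl fun a _ => Finset.sum_congr rfl fun b _ => ?_
    have : -‖z a - z b‖ ^ 2 = -‖z a‖ ^ 2 + -‖z b‖ ^ 2 + 2 * inner ℝ (z a) (z b) := by
      rw [@norm_sub_sq ℝ]
      simp only [RCLike.re_to_real]
      ring
    rw [this, Real.exp_add, Real.exp_add]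
    ring
  rw [hw]
  refine hsum.nonneg fun n => ?_
  have hn : ∑ a, ∑ b, w a * w b * ((2 * inner ℝ (z a) (z b)) ^ n / n.factorial) =
      (2 ^ n / n.factorial) * ∑ a, ∑ b, w a * w b * inner ℝ (z a) (z b) ^ n := by
    simp only [Finset.mul_sum]
    refine Finset.sum_congr rfl fun a _ => Finset.sum_congr rfl fun b _ => ?_
    ring
  rw [hn]
  exact mul_nonneg (by positivity) (sum_inner_pow_nonneg z w n)

lemma nonneg_of_continuous_of_ne {f : NNReal × NNReal → ℝ} (hf : Continuous f)
    (h : ∀ r, r.1 ≠ 0 → r.2 ≠ 0 → 0 ≤ f r) (r : NNReal × NNReal) : 0 ≤ f r := by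
  have hmem : r ∈ closure (Set.Ioi (0 : NNReal) ×ˢ Set.Ioi (0 : NNReal)) := by
    rw [closure_prod_eq, closure_Ioi]
    simp
  exact closure_minimal (fun r hr => h r (ne_of_gt hr.1) (ne_of_gt hr.2))
    (isClosed_le continuous_const hf) hmem

section PDI

variable {n m : ℕ} {E F : Type*} [NormedAddCommGroup E] [InnerProductSpace ℝ E]
  [NormedAddCommGroup F] [InnerProductSpace ℝ F]

lemma sum_exp_mul_exp_nonneg (x : Fin n → E) (y : Fin m → F) (c : Fin n → Fin m → ℝ)
    (a b : NNReal) :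
    0 ≤ ∑ i, ∑ j, ∑ k, ∑ l, c i k * c j l *
      (Real.exp (-(a : ℝ) * ‖x i - x j‖ ^ 2) * Real.exp (-(b : ℝ) * ‖y k - y l‖ ^ 2)) := by
  have h := sum_exp_neg_norm_sq_nonneg (ι := Fin n × Fin m) (E := WithLp 2 (E × F))
    (fun p => WithLp.toLp 2 (√(a : ℝ) • x p.1, √(b : ℝ) • y p.2)) (fun p => c p.1 p.2)
  have hz (p q : Fin n × Fin m) :
      -‖WithLp.toLp 2 (√(a : ℝ) • x p.1, √(b : ℝ) • y p.2) -
        WithLp.toLp 2 (√(a : ℝ) • x q.1, √(b : ℝ) • y q.2)‖ ^ 2 =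
      -(a : ℝ) * ‖x p.1 - x q.1‖ ^ 2 + -(b : ℝ) * ‖y p.2 - y q.2‖ ^ 2 := by
    rw [← WithLp.toLp_sub, WithLp.prod_norm_sq_eq_of_L2]
    simp only [Prod.mk_sub_mk, ← smul_sub, WithLp.toLp_fst, WithLp.toLp_snd, norm_smul,
      mul_pow, Real.norm_eq_abs, sq_abs, Real.sq_sqrt (NNReal.coe_nonneg _)]
    ring
  simp only [hz, Real.exp_add, Fintype.sum_prod_type] at h
  refine h.trans_eq (Finset.sum_congr rfl fun i _ => ?_)
  rw [Finset.sum_comm]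

lemma sum_mul_of_marginals {c : Fin n → Fin m → ℝ} (hc1 : ∀ k, ∑ i, c i k = 0)
    (hc2 : ∀ i, ∑ k, c i k = 0) (e : Fin n → Fin n → ℝ) (f : Fin m → Fin m → ℝ) :
    ∑ i, ∑ j, ∑ k, ∑ l, c i k * c j l * ((1 - e i j) * (1 - f k l)) =
      ∑ i, ∑ j, ∑ k, ∑ l, c i k * c j l * (e i j * f k l) := by
  have h1 : ∑ i, ∑ j, ∑ k, ∑ l, c i k * c j l * (1 - e i j) = 0 := by
    simp only [← Finset.sum_mul, ← Finset.mul_sum, hc2, mul_zero, zero_mul, Finset.sum_const_zero]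
  have h2 : ∑ i, ∑ j, ∑ k, ∑ l, c i k * c j l * f k l = 0 := by
    rw [Finset.sum_comm]
    refine Finset.sum_eq_zero fun j _ => ?_
    rw [Finset.sum_comm]
    refine Finset.sum_eq_zero fun k _ => ?_
    rw [Finset.sum_comm]
    refine Finset.sum_eq_zero fun l _ => ?_
    simp only [← Finset.sum_mul, hc1, zero_mul]
  have h3 (i j k l) : c i k * c j l * ((1 - e i j) * (1 - f k l)) =
      c i k * c j l * (1 - e i j) - c i k * c j l * f k l + c i k * c j l * (e i j * f k l) := by
    ring
  simp only [h3, Finset.sum_add_distrib, Finset.sum_sub_distrib, h1, h2]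
  ring

lemma sum_G10_mul_G10_nonneg_of_ne (x : Fin n → E) (y : Fin m → F) {c : Fin n → Fin m → ℝ}
    (hc1 : ∀ k, ∑ i, c i k = 0) (hc2 : ∀ i, ∑ k, c i k = 0) {a b : NNReal} (ha : a ≠ 0)
    (hb : b ≠ 0) :
    0 ≤ ∑ i, ∑ j, ∑ k, ∑ l, c i k * c j l *
      (G10 a (‖x i - x j‖ ^ 2) * G10 b (‖y k - y l‖ ^ 2)) := by
  have hm := div_nonneg (sum_exp_mul_exp_nonneg x y c a b)
    (mul_nonneg (NNReal.coe_nonneg a) (NNReal.coe_nonneg b))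
  rw [← sum_mul_of_marginals hc1 hc2] at hm
  refine hm.trans_eq ?_
  simp only [Finset.sum_div]
  refine Finset.sum_congr rfl fun i _ => Finset.sum_congr rfl fun j _ =>
    Finset.sum_congr rfl fun k _ => Finset.sum_congr rfl fun l _ => ?_
  rw [G10_of_ne ha, G10_of_ne hb, div_mul_div_comm, mul_div_assoc]

lemma sum_G10_mul_G10_nonneg (x : Fin n → E) (y : Fin m → F) {c : Fin n → Fin m → ℝ}
    (hc1 : ∀ k, ∑ i, c i k = 0) (hc2 : ∀ i, ∑ k, c i k = 0) (a b : NNReal) :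
    0 ≤ ∑ i, ∑ j, ∑ k, ∑ l, c i k * c j l *
      (G10 a (‖x i - x j‖ ^ 2) * G10 b (‖y k - y l‖ ^ 2)) := by
  have hcont : Continuous fun r : NNReal × NNReal => ∑ i, ∑ j, ∑ k, ∑ l, c i k * c j l *
      (G10 r.1 (‖x i - x j‖ ^ 2) * G10 r.2 (‖y k - y l‖ ^ 2)) := by
    refine continuous_finsetSum _ fun i _ => continuous_finsetSum _ fun j _ =>
      continuous_finsetSum _ fun k _ => continuous_finsetSum _ fun l _ => continuous_const.mul ?_
    exact ((continuous_G10 _).comp continuous_fst).mul ((continuous_G10 _).comp continuous_snd)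
  exact nonneg_of_continuous_of_ne hcont
    (fun r h1 h2 => sum_G10_mul_G10_nonneg_of_ne x y hc1 hc2 h1 h2) (a, b)

lemma isPDI_of_integral_G10 {g : ℝ → ℝ → ℝ} {ν : Measure (NNReal × NNReal)} [IsFiniteMeasure ν]
    (hg : ∀ t₁ t₂ : ℝ, 0 ≤ t₁ → 0 ≤ t₂ →
      g t₁ t₂ = ∫ r, G10 r.1 t₁ * G10 r.2 t₂ * (1 + (r.1 : ℝ)) * (1 + (r.2 : ℝ)) ∂ν) :
    IsPDI (fun p q : E × F => g (‖p.1 - q.1‖ ^ 2) (‖p.2 - q.2‖ ^ 2)) := by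
  intro n m x y c hc1 hc2
  have hintegrable (i j k l) : Integrable (fun r : NNReal × NNReal => c i k * c j l *
      (G10 r.1 (‖x i - x j‖ ^ 2) * G10 r.2 (‖y k - y l‖ ^ 2) *
        (1 + (r.1 : ℝ)) * (1 + (r.2 : ℝ)))) ν :=
    (integrable_G10_kernel (sq_nonneg _) (sq_nonneg _)).const_mul _
  have hrw : ∑ i, ∑ j, ∑ k, ∑ l, c i k * c j l * g (‖x i - x j‖ ^ 2) (‖y k - y l‖ ^ 2) =
      ∫ r, ∑ i, ∑ j, ∑ k, ∑ l, c i k * c j l *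
        (G10 r.1 (‖x i - x j‖ ^ 2) * G10 r.2 (‖y k - y l‖ ^ 2) *
          (1 + (r.1 : ℝ)) * (1 + (r.2 : ℝ))) ∂ν := by
    rw [integral_finsetSum _ fun i _ => integrable_finsetSum _ fun j _ =>
      integrable_finsetSum _ fun k _ => integrable_finsetSum _ fun l _ => hintegrable i j k l]
    refine Finset.sum_congr rfl fun i _ => ?_
    rw [integral_finsetSum _ fun j _ =>
      integrable_finsetSum _ fun k _ => integrable_finsetSum _ fun l _ => hintegrable i j k l]
    refine Finset.sum_congr rfl fun j _ => ?_
    rw [integral_finsetSum _ fun k _ => integrable_finsetSum _ fun l _ => hintegrable i j k l]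
    refine Finset.sum_congr rfl fun k _ => ?_
    rw [integral_finsetSum _ fun l _ => hintegrable i j k l]
    refine Finset.sum_congr rfl fun l _ => ?_
    rw [integral_const_mul, hg _ _ (sq_nonneg _) (sq_nonneg _)]
  refine (integral_nonneg fun r => ?_).trans_eq hrw.symm
  have h := mul_nonneg (sum_G10_mul_G10_nonneg x y hc1 hc2 r.1 r.2)
    (by positivity : 0 ≤ (1 + (r.1 : ℝ)) * (1 + (r.2 : ℝ)))
  refine h.trans_eq ?_
  simp only [Finset.sum_mul]
  refine Finset.sum_congr rfl fun i _ => Finset.sum_congr rfl fun j _ =>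
    Finset.sum_congr rfl fun k _ => Finset.sum_congr rfl fun l _ => ?_
  ring

end PDI

/-- Equality of two functions of two variables on the open quadrant. -/
def QuadrantEq (f g : ℝ → ℝ → ℝ) : Prop := ∀ s t : ℝ, 0 < s → 0 < t → f s t = g s t

/-- Smoothness of a function of two variables on the open quadrant. -/
def QuadrantSmooth (f : ℝ → ℝ → ℝ) : Prop :=
  ContDiffOn ℝ ((⊤ : ℕ∞) : WithTop ℕ∞) (fun p : ℝ × ℝ => f p.1 p.2) (Set.Ioi 0 ×ˢ Set.Ioi 0)

lemma isOpen_quadrant : IsOpen (Set.Ioi (0 : ℝ) ×ˢ Set.Ioi (0 : ℝ)) := isOpen_Ioi.prod isOpen_Ioi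

lemma quadrant_mem_nhds {s t : ℝ} (hs : 0 < s) (ht : 0 < t) :
    Set.Ioi (0 : ℝ) ×ˢ Set.Ioi (0 : ℝ) ∈ 𝓝 (s, t) :=
  isOpen_quadrant.mem_nhds ⟨hs, ht⟩

namespace QuadrantEq

variable {f g k : ℝ → ℝ → ℝ}

lemma trans (h : QuadrantEq f g) (h' : QuadrantEq g k) : QuadrantEq f k :=
  fun s t hs ht => (h s t hs ht).trans (h' s t hs ht)

lemma pd1 (h : QuadrantEq f g) : QuadrantEq (pd1 f) (pd1 g) := fun s t hs ht => by
  refine Filter.EventuallyEq.deriv_eq ?_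
  filter_upwards [Ioi_mem_nhds hs] with u hu using h u t hu ht

lemma pd2 (h : QuadrantEq f g) : QuadrantEq (pd2 f) (pd2 g) := fun s t hs ht => by
  refine Filter.EventuallyEq.deriv_eq ?_
  filter_upwards [Ioi_mem_nhds ht] with u hu using h s u hs hu

lemma pd1_iterate (h : QuadrantEq f g) (i : ℕ) :
    QuadrantEq (_root_.pd1^[i] f) (_root_.pd1^[i] g) := by
  induction i with
  | zero => exact h
  | succ i ih =>
    rw [Function.iterate_succ_apply', Function.iterate_succ_apply']
    exact ih.pd1

lemma pd2_iterate (h : QuadrantEq f g) (i : ℕ) :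
    QuadrantEq (_root_.pd2^[i] f) (_root_.pd2^[i] g) := by
  induction i with
  | zero => exact h
  | succ i ih =>
    rw [Function.iterate_succ_apply', Function.iterate_succ_apply']
    exact ih.pd2

end QuadrantEq

namespace QuadrantSmooth

variable {f g : ℝ → ℝ → ℝ}

lemma congr (hf : QuadrantSmooth f) (h : QuadrantEq g f) : QuadrantSmooth g :=
  ContDiffOn.congr hf fun p hp => h p.1 p.2 hp.1 hp.2

lemma differentiableAt (hf : QuadrantSmooth f) {s t : ℝ} (hs : 0 < s) (ht : 0 < t) :
    DifferentiableAt ℝ (fun p : ℝ × ℝ => f p.1 p.2) (s, t) :=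
  (ContDiffOn.contDiffAt hf (quadrant_mem_nhds hs ht)).differentiableAt (by simp)

lemma hasDerivAt_fst (hf : QuadrantSmooth f) {s t : ℝ} (hs : 0 < s) (ht : 0 < t) :
    HasDerivAt (fun u => f u t) (fderiv ℝ (fun p : ℝ × ℝ => f p.1 p.2) (s, t) (1, 0)) s :=
  (hf.differentiableAt hs ht).hasFDerivAt.comp_hasDerivAt (f := fun u => (u, t)) s
    ((hasDerivAt_id s).prodMk (hasDerivAt_const s t))

lemma hasDerivAt_snd (hf : QuadrantSmooth f) {s t : ℝ} (hs : 0 < s) (ht : 0 < t) :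
    HasDerivAt (fun u => f s u) (fderiv ℝ (fun p : ℝ × ℝ => f p.1 p.2) (s, t) (0, 1)) t :=
  (hf.differentiableAt hs ht).hasFDerivAt.comp_hasDerivAt (f := fun u => (s, u)) t
    ((hasDerivAt_const t s).prodMk (hasDerivAt_id t))

lemma pd1_eq (hf : QuadrantSmooth f) :
    QuadrantEq (_root_.pd1 f) (fun s t => fderiv ℝ (fun p : ℝ × ℝ => f p.1 p.2) (s, t) (1, 0)) :=
  fun _ _ hs ht => (hf.hasDerivAt_fst hs ht).deriv

lemma pd2_eq (hf : QuadrantSmooth f) :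
    QuadrantEq (_root_.pd2 f) (fun s t => fderiv ℝ (fun p : ℝ × ℝ => f p.1 p.2) (s, t) (0, 1)) :=
  fun _ _ hs ht => (hf.hasDerivAt_snd hs ht).deriv

lemma hasDerivAt_pd1 (hf : QuadrantSmooth f) {s t : ℝ} (hs : 0 < s) (ht : 0 < t) :
    HasDerivAt (fun u => f u t) (_root_.pd1 f s t) s :=
  (hf.hasDerivAt_fst hs ht).differentiableAt.hasDerivAt

lemma hasDerivAt_pd2 (hf : QuadrantSmooth f) {s t : ℝ} (hs : 0 < s) (ht : 0 < t) :
    HasDerivAt (fun u => f s u) (_root_.pd2 f s t) t :=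
  (hf.hasDerivAt_snd hs ht).differentiableAt.hasDerivAt

lemma fderiv_apply (hf : QuadrantSmooth f) (v : ℝ × ℝ) :
    QuadrantSmooth (fun s t => fderiv ℝ (fun p : ℝ × ℝ => f p.1 p.2) (s, t) v) :=
  (ContDiffOn.fderiv_of_isOpen hf isOpen_quadrant (by simp)).clm_apply contDiffOn_const

lemma pd1 (hf : QuadrantSmooth f) : QuadrantSmooth (pd1 f) :=
  (hf.fderiv_apply (1, 0)).congr hf.pd1_eq

lemma pd2 (hf : QuadrantSmooth f) : QuadrantSmooth (pd2 f) :=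
  (hf.fderiv_apply (0, 1)).congr hf.pd2_eq

lemma pd1_iterate (hf : QuadrantSmooth f) (i : ℕ) : QuadrantSmooth (_root_.pd1^[i] f) := by
  induction i with
  | zero => exact hf
  | succ i ih =>
    rw [Function.iterate_succ_apply']
    exact ih.pd1

lemma pd2_iterate (hf : QuadrantSmooth f) (i : ℕ) : QuadrantSmooth (_root_.pd2^[i] f) := by
  induction i with
  | zero => exact hf
  | succ i ih =>
    rw [Function.iterate_succ_apply']
    exact ih.pd2

lemma fderiv_fderiv_apply (hf : QuadrantSmooth f) (v w : ℝ × ℝ) {s t : ℝ} (hs : 0 < s)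
    (ht : 0 < t) :
    fderiv ℝ (fun p : ℝ × ℝ => fderiv ℝ (fun p : ℝ × ℝ => f p.1 p.2) (p.1, p.2) v) (s, t) w =
      fderiv ℝ (fderiv ℝ (fun p : ℝ × ℝ => f p.1 p.2)) (s, t) w v := by
  have h : DifferentiableAt ℝ (fderiv ℝ (fun p : ℝ × ℝ => f p.1 p.2)) (s, t) :=
    ((ContDiffOn.fderiv_of_isOpen hf isOpen_quadrant (m := 1)
      (WithTop.coe_le_coe.2 (le_top (a := 2)))).contDiffAt
      (quadrant_mem_nhds hs ht)).differentiableAt (by simp)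
  have := (h.hasFDerivAt.clm_apply (hasFDerivAt_const v (s, t))).fderiv
  simp only [Prod.mk.eta]
  rw [this]
  simp

lemma pd2_pd1 (hf : QuadrantSmooth f) :
    QuadrantEq (_root_.pd2 (_root_.pd1 f)) (_root_.pd1 (_root_.pd2 f)) := by
  intro s t hs ht
  rw [hf.pd1_eq.pd2 s t hs ht, hf.pd2_eq.pd1 s t hs ht, (hf.fderiv_apply _).pd2_eq s t hs ht,
    (hf.fderiv_apply _).pd1_eq s t hs ht]
  dsimp only
  rw [hf.fderiv_fderiv_apply _ _ hs ht, hf.fderiv_fderiv_apply _ _ hs ht]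
  refine ((ContDiffOn.contDiffAt hf (quadrant_mem_nhds hs ht)).isSymmSndFDerivAt ?_) _ _
  rw [minSmoothness_of_isRCLikeNormedField]
  exact WithTop.coe_le_coe.2 (le_top (a := 2))

lemma pd2_pd1_iterate (hf : QuadrantSmooth f) (i : ℕ) :
    QuadrantEq (_root_.pd2 (_root_.pd1^[i] f)) (_root_.pd1^[i] (_root_.pd2 f)) := by
  induction i with
  | zero => exact fun _ _ _ _ => rfl
  | succ i ih =>
    rw [Function.iterate_succ_apply', Function.iterate_succ_apply']
    exact (hf.pd1_iterate i).pd2_pd1.trans ih.pd1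

/-- Subtracting a translate into the quadrant. -/
lemma sub_shift (hf : QuadrantSmooth f) {a b : ℝ} (ha : 0 ≤ a) (hb : 0 ≤ b) :
    QuadrantSmooth (fun s t => f s t - f (s + a) (t + b)) := by
  refine ContDiffOn.sub hf (ContDiffOn.comp (g := fun p : ℝ × ℝ => f p.1 p.2) hf
    (f := fun p : ℝ × ℝ => (p.1 + a, p.2 + b)) (by fun_prop) ?_)
  exact fun p hp => ⟨add_pos_of_pos_of_nonneg hp.1 ha, add_pos_of_pos_of_nonneg hp.2 hb⟩

lemma pd1_sub_shift (hf : QuadrantSmooth f) {a b : ℝ} (ha : 0 ≤ a) (hb : 0 ≤ b) :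
    QuadrantEq (_root_.pd1 (fun s t => f s t - f (s + a) (t + b)))
      (fun s t => _root_.pd1 f s t - _root_.pd1 f (s + a) (t + b)) := fun s t hs ht =>
  ((hf.hasDerivAt_pd1 hs ht).sub ((hf.hasDerivAt_pd1 (by positivity : 0 < s + a)
    (by positivity : 0 < t + b)).comp_add_const s a)).deriv

lemma pd2_sub_shift (hf : QuadrantSmooth f) {a b : ℝ} (ha : 0 ≤ a) (hb : 0 ≤ b) :
    QuadrantEq (_root_.pd2 (fun s t => f s t - f (s + a) (t + b)))
      (fun s t => _root_.pd2 f s t - _root_.pd2 f (s + a) (t + b)) := fun s t hs ht =>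
  ((hf.hasDerivAt_pd2 hs ht).sub ((hf.hasDerivAt_pd2 (by positivity : 0 < s + a)
    (by positivity : 0 < t + b)).comp_add_const t b)).deriv

lemma pd1_iterate_sub_shift (hf : QuadrantSmooth f) {a b : ℝ} (ha : 0 ≤ a) (hb : 0 ≤ b) (i : ℕ) :
    QuadrantEq (_root_.pd1^[i] (fun s t => f s t - f (s + a) (t + b)))
      (fun s t => _root_.pd1^[i] f s t - _root_.pd1^[i] f (s + a) (t + b)) := by
  induction i with
  | zero => exact fun _ _ _ _ => rfl
  | succ i ih =>
    rw [Function.iterate_succ_apply', Function.iterate_succ_apply']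
    exact ih.pd1.trans ((hf.pd1_iterate i).pd1_sub_shift ha hb)

lemma pd2_iterate_sub_shift (hf : QuadrantSmooth f) {a b : ℝ} (ha : 0 ≤ a) (hb : 0 ≤ b) (i : ℕ) :
    QuadrantEq (_root_.pd2^[i] (fun s t => f s t - f (s + a) (t + b)))
      (fun s t => _root_.pd2^[i] f s t - _root_.pd2^[i] f (s + a) (t + b)) := by
  induction i with
  | zero => exact fun _ _ _ _ => rfl
  | succ i ih =>
    rw [Function.iterate_succ_apply', Function.iterate_succ_apply']
    exact ih.pd2.trans ((hf.pd2_iterate i).pd2_sub_shift ha hb)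

lemma le_of_pd1_nonneg (hf : QuadrantSmooth f)
    (h : ∀ s t, 0 < s → 0 < t → 0 ≤ _root_.pd1 f s t) {s t a : ℝ} (hs : 0 < s) (ht : 0 < t)
    (ha : 0 ≤ a) : f s t ≤ f (s + a) t := by
  refine monotoneOn_of_deriv_nonneg (f := fun u => f u t) (convex_Ioi (0 : ℝ))
    (fun u hu => (hf.hasDerivAt_pd1 hu ht).continuousAt.continuousWithinAt)
    (fun u hu => ?_) (fun u hu => ?_) hs (by positivity : 0 < s + a) (by linarith)
  · rw [interior_Ioi] at hu
    exact (hf.hasDerivAt_pd1 hu ht).differentiableAt.differentiableWithinAt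
  · rw [interior_Ioi] at hu
    exact h u t hu ht

lemma le_of_pd2_nonneg (hf : QuadrantSmooth f)
    (h : ∀ s t, 0 < s → 0 < t → 0 ≤ _root_.pd2 f s t) {s t b : ℝ} (hs : 0 < s) (ht : 0 < t)
    (hb : 0 ≤ b) : f s t ≤ f s (t + b) := by
  refine monotoneOn_of_deriv_nonneg (f := fun u => f s u) (convex_Ioi (0 : ℝ))
    (fun u hu => (hf.hasDerivAt_pd2 hs hu).continuousAt.continuousWithinAt)
    (fun u hu => ?_) (fun u hu => ?_) ht (by positivity : 0 < t + b) (by linarith)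
  · rw [interior_Ioi] at hu
    exact (hf.hasDerivAt_pd2 hs hu).differentiableAt.differentiableWithinAt
  · rw [interior_Ioi] at hu
    exact h s u hs hu

lemma const_mul (hf : QuadrantSmooth f) (C : ℝ) : QuadrantSmooth (fun s t => C * f s t) :=
  ContDiffOn.mul contDiffOn_const hf

end QuadrantSmooth

namespace IsBernstein2

variable {g : ℝ → ℝ → ℝ}

lemma sub_shift (hg : IsBernstein2 g) {a b : ℝ} (ha : 0 ≤ a) (hb : 0 ≤ b) :
    IsBernstein2 (fun s t => g s t - g (s + a) (t + b)) := by
  have hsm : QuadrantSmooth g := hg.2.1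
  refine ⟨hg.1.sub (hg.1.comp (f := fun p : ℝ × ℝ => (p.1 + a, p.2 + b)) (by fun_prop) fun p hp =>
    ⟨add_nonneg hp.1 ha, add_nonneg hp.2 hb⟩), hsm.sub_shift ha hb, fun i j s t hs ht => ?_⟩
  have hf : QuadrantSmooth (pd1 (pd2 g)) := hsm.pd2.pd1
  have e1 := (hsm.pd2_sub_shift ha hb).pd1.trans (hsm.pd2.pd1_sub_shift ha hb)
  have e2 := (e1.pd2_iterate j).trans (hf.pd2_iterate_sub_shift ha hb j)
  have e3 := (e2.pd1_iterate i).trans ((hf.pd2_iterate j).pd1_iterate_sub_shift ha hb i)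
  rw [e3 s t hs ht]
  have hF : QuadrantSmooth (pd1^[i] (pd2^[j] (pd1 (pd2 g)))) := (hf.pd2_iterate j).pd1_iterate i
  have hC := hF.const_mul ((-1) ^ (i + j + 1))
  have h1 := hC.le_of_pd1_nonneg (fun s t hs ht => by
    have h := hg.2.2 (i + 1) j s t hs ht
    rw [Function.iterate_succ_apply'] at h
    rw [show i + 1 + j = i + j + 1 by ring] at h
    exact h.trans_eq ((hF.hasDerivAt_pd1 hs ht).const_mul _).deriv.symm) hs ht ha
  have h2 := hC.le_of_pd2_nonneg (fun s t hs ht => by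
    have h := hg.2.2 i (j + 1) s t hs ht
    rw [Function.iterate_succ_apply', ← ((hf.pd2_iterate j).pd2_pd1_iterate i) s t hs ht] at h
    exact h.trans_eq ((hF.hasDerivAt_pd2 hs ht).const_mul _).deriv.symm)
    (by positivity : 0 < s + a) ht hb
  rw [pow_succ] at h1 h2
  linarith

lemma mixedDiff_nonneg (hg : IsBernstein2 g) {h k s t : ℝ} (hh : 0 ≤ h)
    (hk : 0 ≤ k) (hs : 0 ≤ s) (ht : 0 ≤ t) : 0 ≤ mixedDiff g h k s t := by
  have hsm : QuadrantSmooth g := hg.2.1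
  have hpos : ∀ p ∈ Set.Ioi (0 : ℝ) ×ˢ Set.Ioi (0 : ℝ), 0 ≤ mixedDiff g h k p.1 p.2 := by
    rintro ⟨s, t⟩ ⟨hs, ht⟩
    simp only [Set.mem_Ioi] at hs ht
    have hC := ((hsm.sub_shift hh le_rfl).const_mul (-1))
    have h1 := hC.le_of_pd2_nonneg (fun s t hs ht => by
      have h1 := hsm.pd2.le_of_pd1_nonneg (fun s t hs ht => by simpa using hg.2.2 0 0 s t hs ht)
        hs ht hh
      have h2 := (((hsm.sub_shift hh le_rfl).hasDerivAt_pd2 hs ht).const_mul (-1)).deriv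
      rw [hsm.pd2_sub_shift hh le_rfl s t hs ht] at h2
      simp only [add_zero] at h2 ⊢
      exact (by linarith : 0 ≤ -1 * (pd2 g s t - pd2 g (s + h) t)).trans_eq h2.symm) hs ht hk
    simp only [add_zero] at h1
    rw [mixedDiff]
    linarith
  have hcl : (s, t) ∈ closure (Set.Ioi (0 : ℝ) ×ˢ Set.Ioi (0 : ℝ)) := by
    rw [closure_prod_eq, closure_Ioi]
    exact ⟨hs, ht⟩
  have := mem_closure_iff_nhdsWithin_neBot.1 hcl
  have hcont (a b : ℝ) (ha : 0 ≤ a) (hb : 0 ≤ b) :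
      ContinuousOn (fun p : ℝ × ℝ => g (p.1 + a) (p.2 + b)) (Set.Ici 0 ×ˢ Set.Ici 0) :=
    hg.1.comp (f := fun p : ℝ × ℝ => (p.1 + a, p.2 + b)) (by fun_prop) fun p hp =>
      ⟨add_nonneg hp.1 ha, add_nonneg hp.2 hb⟩
  have hmd : ContinuousOn (fun p : ℝ × ℝ => mixedDiff g h k p.1 p.2) (Set.Ici 0 ×ˢ Set.Ici 0) := by
    refine (((hcont h k hh hk).sub (hcont h 0 hh le_rfl)).sub
      ((hcont 0 k le_rfl hk).sub hg.1)).congr fun p _ => ?_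
    simp [mixedDiff]
  refine ge_of_tendsto ((hmd (s, t) ⟨hs, ht⟩).mono_left (nhdsWithin_mono _
    (Set.prod_mono Set.Ioi_subset_Ici_self Set.Ioi_subset_Ici_self))) ?_
  filter_upwards [self_mem_nhdsWithin] with p hp using hpos p hp

lemma completelyMonotoneSeq (hg : IsBernstein2 g) {h : ℝ} (hh : 0 < h) :
    CompletelyMonotoneSeq (fun i j => mixedDiff g h h (i * h) (j * h)) :=
  completelyMonotoneSeq_mixedDiff hh
    (fun _ hg => by simpa only [add_zero] using hg.sub_shift hh.le le_rfl)
    (fun _ hg => by simpa only [add_zero] using hg.sub_shift le_rfl hh.le)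
    (fun _ hg _ _ hs ht => hg.mixedDiff_nonneg hh.le hh.le hs ht) hg

end IsBernstein2

lemma hasDerivAt_G10 (r : NNReal) (s : ℝ) : HasDerivAt (G10 r) (Real.exp (-(r : ℝ) * s)) s := by
  rcases eq_or_ne r 0 with rfl | hr
  · rw [show G10 0 = fun s => s from funext G10_zero_left]
    simpa using hasDerivAt_id' s
  · have hr0 : (r : ℝ) ≠ 0 := by exact_mod_cast hr
    rw [show G10 r = fun s => (1 - Real.exp (-(r : ℝ) * s)) / (r : ℝ) from funext (G10_of_ne hr)]
    have h := ((((hasDerivAt_id s).const_mul (-(r : ℝ))).exp).const_sub 1).div_const (r : ℝ)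
    convert! h using 1
    simp only [id]
    field_simp

/-- The `i`-th derivative in `s` of the weighted kernel `G10 r s * (1 + r)`. -/
def kernelDeriv : ℕ → NNReal → ℝ → ℝ
  | 0, r, s => G10 r s * (1 + r)
  | i + 1, r, s => (-(r : ℝ)) ^ i * Real.exp (-(r : ℝ) * s) * (1 + r)

lemma hasDerivAt_kernelDeriv (i : ℕ) (r : NNReal) (s : ℝ) :
    HasDerivAt (kernelDeriv i r) (kernelDeriv (i + 1) r s) s := by
  cases i with
  | zero =>
    convert! (hasDerivAt_G10 r s).mul_const (1 + (r : ℝ)) using 1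
    simp [kernelDeriv]
  | succ i =>
    have h := (((((hasDerivAt_id s).const_mul (-(r : ℝ))).exp).const_mul
      ((-(r : ℝ)) ^ i)).mul_const (1 + (r : ℝ)))
    convert! h using 1
    simp only [kernelDeriv, id]
    ring

lemma continuous_kernelDeriv (i : ℕ) (s : ℝ) : Continuous fun r => kernelDeriv i r s := by
  cases i with
  | zero => exact (continuous_G10 s).mul (by fun_prop)
  | succ i =>
    simp only [kernelDeriv]
    fun_prop

lemma pow_mul_exp_neg_le {a x : ℝ} (ha : 0 < a) (hx : 0 ≤ x) (k : ℕ) :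
    x ^ k * Real.exp (-x * a) ≤ k.factorial / a ^ k := by
  have h := Real.pow_div_factorial_le_exp _ (mul_nonneg hx ha.le) k
  rw [div_le_iff₀ (by positivity), mul_pow] at h
  rw [neg_mul, Real.exp_neg, ← div_eq_mul_inv, div_le_div_iff₀ (Real.exp_pos _) (by positivity),
    mul_comm _ (Real.exp _)]
  exact h

lemma exists_bound_kernelDeriv (i : ℕ) {a b : ℝ} (ha : 0 < a) :
    ∃ C, ∀ r, ∀ s ∈ Set.Ioo a b, |kernelDeriv i r s| ≤ C := by
  cases i with
  | zero =>
    exact ⟨b + 1, fun r s hs => (abs_G10_mul_le r (ha.trans hs.1).le).trans (by linarith [hs.2])⟩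
  | succ i =>
    refine ⟨i.factorial / a ^ i + (i + 1).factorial / a ^ (i + 1), fun r s hs => ?_⟩
    have hr : (0 : ℝ) ≤ r := r.2
    have h1 := pow_mul_exp_neg_le ha hr i
    have h2 := pow_mul_exp_neg_le ha hr (i + 1)
    have h3 : Real.exp (-(r : ℝ) * s) ≤ Real.exp (-(r : ℝ) * a) :=
      Real.exp_le_exp.2 (mul_le_mul_of_nonpos_left hs.1.le (neg_nonpos.2 hr))
    rw [kernelDeriv, abs_mul, abs_mul, abs_pow, abs_neg, abs_of_nonneg hr,
      abs_of_pos (Real.exp_pos _), abs_of_nonneg (by positivity : 0 ≤ 1 + (r : ℝ))]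
    calc (r : ℝ) ^ i * Real.exp (-(r : ℝ) * s) * (1 + r)
        ≤ (r : ℝ) ^ i * Real.exp (-(r : ℝ) * a) * (1 + r) := by gcongr
      _ = (r : ℝ) ^ i * Real.exp (-(r : ℝ) * a) + (r : ℝ) ^ (i + 1) * Real.exp (-(r : ℝ) * a) := by
        ring
      _ ≤ _ := add_le_add h1 h2

/-- The mixed derivative of order `(i, j)` of the integral of the weighted kernel. -/
def kernelIntegral (ν : Measure (NNReal × NNReal)) (i j : ℕ) (s t : ℝ) : ℝ :=
  ∫ r, kernelDeriv i r.1 s * kernelDeriv j r.2 t ∂ν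

lemma neg_one_pow_mul_kernelIntegral_nonneg (ν : Measure (NNReal × NNReal)) (i j : ℕ) (s t : ℝ) :
    0 ≤ (-1 : ℝ) ^ (i + j) * kernelIntegral ν (1 + i) (1 + j) s t := by
  rw [kernelIntegral, ← integral_const_mul]
  refine integral_nonneg fun r => ?_
  have : (-1 : ℝ) ^ (i + j) * (kernelDeriv (1 + i) r.1 s * kernelDeriv (1 + j) r.2 t) =
      ((r.1 : ℝ) ^ i * Real.exp (-(r.1 : ℝ) * s) * (1 + r.1)) *
        ((r.2 : ℝ) ^ j * Real.exp (-(r.2 : ℝ) * t) * (1 + r.2)) := by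
    rw [add_comm 1 i, add_comm 1 j, kernelDeriv, kernelDeriv, neg_pow (r.1 : ℝ),
      neg_pow (r.2 : ℝ), pow_add]
    have h (n : ℕ) : (-1 : ℝ) ^ n * (-1) ^ n = 1 := by rw [← mul_pow]; simp
    linear_combination ((r.1 : ℝ) ^ i * Real.exp (-(r.1 : ℝ) * s) * (1 + r.1)) *
      ((r.2 : ℝ) ^ j * Real.exp (-(r.2 : ℝ) * t) * (1 + r.2)) *
      ((-1) ^ j * (-1) ^ j * h i + h j)
  rw [Pi.zero_apply, this]
  positivity

section KernelIntegral

variable (ν : Measure (NNReal × NNReal)) [IsFiniteMeasure ν]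

lemma continuous_kernelDeriv_mul (i j : ℕ) (s t : ℝ) :
    Continuous fun r : NNReal × NNReal => kernelDeriv i r.1 s * kernelDeriv j r.2 t :=
  ((continuous_kernelDeriv i s).comp continuous_fst).mul
    ((continuous_kernelDeriv j t).comp continuous_snd)

lemma exists_bound_kernelDeriv_mul (i j : ℕ) {a b a' b' : ℝ} (ha : 0 < a) (ha' : 0 < a') :
    ∃ C, ∀ r : NNReal × NNReal, ∀ p ∈ Set.Ioo a b ×ˢ Set.Ioo a' b',
      |kernelDeriv i r.1 p.1 * kernelDeriv j r.2 p.2| ≤ C := by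
  obtain ⟨C, hC⟩ := exists_bound_kernelDeriv i (b := b) ha
  obtain ⟨D, hD⟩ := exists_bound_kernelDeriv j (b := b') ha'
  refine ⟨C * D, fun r p hp => ?_⟩
  rw [abs_mul]
  exact mul_le_mul (hC _ _ hp.1) (hD _ _ hp.2) (abs_nonneg _) ((abs_nonneg _).trans (hC r.1 _ hp.1))

lemma integrable_kernelDeriv_mul (i j : ℕ) {s t : ℝ} (hs : 0 < s) (ht : 0 < t) :
    Integrable (fun r : NNReal × NNReal => kernelDeriv i r.1 s * kernelDeriv j r.2 t) ν := by
  obtain ⟨C, hC⟩ := exists_bound_kernelDeriv_mul i j (b := 2 * s) (b' := 2 * t)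
    (half_pos hs) (half_pos ht)
  exact Integrable.of_bound (continuous_kernelDeriv_mul i j s t).aestronglyMeasurable C
    (Eventually.of_forall fun r => hC r (s, t)
      ⟨⟨by linarith, by linarith⟩, ⟨by linarith, by linarith⟩⟩)

lemma hasFDerivAt_kernelIntegral (i j : ℕ) {s t : ℝ} (hs : 0 < s) (ht : 0 < t) :
    HasFDerivAt (fun p : ℝ × ℝ => kernelIntegral ν i j p.1 p.2)
      (kernelIntegral ν (i + 1) j s t • ContinuousLinearMap.fst ℝ ℝ ℝ +
        kernelIntegral ν i (j + 1) s t • ContinuousLinearMap.snd ℝ ℝ ℝ) (s, t) := by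
  obtain ⟨C, hC⟩ := exists_bound_kernelDeriv_mul (i + 1) j (b := 2 * s) (b' := 2 * t)
    (half_pos hs) (half_pos ht)
  obtain ⟨D, hD⟩ := exists_bound_kernelDeriv_mul i (j + 1) (b := 2 * s) (b' := 2 * t)
    (half_pos hs) (half_pos ht)
  let F' : ℝ × ℝ → NNReal × NNReal → ℝ × ℝ →L[ℝ] ℝ := fun p r =>
    (kernelDeriv (i + 1) r.1 p.1 * kernelDeriv j r.2 p.2) • ContinuousLinearMap.fst ℝ ℝ ℝ +
      (kernelDeriv i r.1 p.1 * kernelDeriv (j + 1) r.2 p.2) • ContinuousLinearMap.snd ℝ ℝ ℝ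
  have hnhds : Set.Ioo (s / 2) (2 * s) ×ˢ Set.Ioo (t / 2) (2 * t) ∈ 𝓝 (s, t) :=
    prod_mem_nhds (Ioo_mem_nhds (by linarith) (by linarith))
      (Ioo_mem_nhds (by linarith) (by linarith))
  have h := hasFDerivAt_integral_of_dominated_of_fderiv_le (μ := ν) (x₀ := (s, t)) (F' := F')
    (F := fun p r => kernelDeriv i r.1 p.1 * kernelDeriv j r.2 p.2) (bound := fun _ => C + D) hnhds
    (Eventually.of_forall fun p => (continuous_kernelDeriv_mul i j p.1 p.2).aestronglyMeasurable)
    (integrable_kernelDeriv_mul ν i j hs ht)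
    (((continuous_kernelDeriv_mul (i + 1) j s t).smul continuous_const).add
      ((continuous_kernelDeriv_mul i (j + 1) s t).smul continuous_const)).aestronglyMeasurable
    (Eventually.of_forall fun r p hp => ?_) (integrable_const _)
    (Eventually.of_forall fun r p hp => ?_)
  · convert! h using 1
    rw [integral_add ((integrable_kernelDeriv_mul ν _ _ hs ht).smul_const _)
      ((integrable_kernelDeriv_mul ν _ _ hs ht).smul_const _), integral_smul_const,
      integral_smul_const]
    rfl
  · refine (norm_add_le _ _).trans (add_le_add ?_ ?_)
    · rw [norm_smul]
      exact (mul_le_of_le_one_right (norm_nonneg _)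
        (ContinuousLinearMap.norm_fst_le ℝ ℝ ℝ)).trans (hC r p hp)
    · rw [norm_smul]
      exact (mul_le_of_le_one_right (norm_nonneg _)
        (ContinuousLinearMap.norm_snd_le ℝ ℝ ℝ)).trans (hD r p hp)
  · have h1 := (hasDerivAt_kernelDeriv i r.1 p.1).comp_hasFDerivAt p
      (hasFDerivAt_fst (𝕜 := ℝ) (E := ℝ) (F := ℝ))
    have h2 := (hasDerivAt_kernelDeriv j r.2 p.2).comp_hasFDerivAt p
      (hasFDerivAt_snd (𝕜 := ℝ) (E := ℝ) (F := ℝ))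
    convert! h1.mul h2 using 1
    simp only [F', Function.comp_apply, smul_smul]
    rw [add_comm, mul_comm (kernelDeriv (i + 1) r.1 p.1)]

lemma quadrantSmooth_kernelIntegral (i j : ℕ) : QuadrantSmooth (kernelIntegral ν i j) := by
  refine contDiffOn_infty.2 fun n => ?_
  induction n generalizing i j with
  | zero =>
    exact contDiffOn_zero.2 fun p hp =>
      (hasFDerivAt_kernelIntegral ν i j hp.1 hp.2).continuousAt.continuousWithinAt
  | succ n ih =>
    push_cast
    rw [contDiffOn_succ_iff_fderiv_of_isOpen isOpen_quadrant]
    refine ⟨fun p hp => (hasFDerivAt_kernelIntegral ν i j hp.1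
      hp.2).differentiableAt.differentiableWithinAt, by simp, ?_⟩
    refine (((ih (i + 1) j).smul (contDiffOn_const (c := ContinuousLinearMap.fst ℝ ℝ ℝ))).add
      ((ih i (j + 1)).smul (contDiffOn_const (c := ContinuousLinearMap.snd ℝ ℝ ℝ)))).congr
      fun p hp => ?_
    exact (hasFDerivAt_kernelIntegral ν i j hp.1 hp.2).fderiv

lemma pd1_kernelIntegral (i j : ℕ) :
    QuadrantEq (pd1 (kernelIntegral ν i j)) (kernelIntegral ν (i + 1) j) := fun s t hs ht => by
  rw [(quadrantSmooth_kernelIntegral ν i j).pd1_eq s t hs ht]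
  dsimp only
  rw [(hasFDerivAt_kernelIntegral ν i j hs ht).fderiv]
  simp

lemma pd2_kernelIntegral (i j : ℕ) :
    QuadrantEq (pd2 (kernelIntegral ν i j)) (kernelIntegral ν i (j + 1)) := fun s t hs ht => by
  rw [(quadrantSmooth_kernelIntegral ν i j).pd2_eq s t hs ht]
  dsimp only
  rw [(hasFDerivAt_kernelIntegral ν i j hs ht).fderiv]
  simp

lemma pd1_iterate_kernelIntegral (i j k : ℕ) :
    QuadrantEq (pd1^[k] (kernelIntegral ν i j)) (kernelIntegral ν (i + k) j) := by
  induction k with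
  | zero => exact fun _ _ _ _ => rfl
  | succ k ih =>
    rw [Function.iterate_succ_apply']
    exact ih.pd1.trans (pd1_kernelIntegral ν (i + k) j)

lemma pd2_iterate_kernelIntegral (i j k : ℕ) :
    QuadrantEq (pd2^[k] (kernelIntegral ν i j)) (kernelIntegral ν i (j + k)) := by
  induction k with
  | zero => exact fun _ _ _ _ => rfl
  | succ k ih =>
    rw [Function.iterate_succ_apply']
    exact ih.pd2.trans (pd2_kernelIntegral ν i (j + k))

lemma isBernstein2_of_integral_G10 {g : ℝ → ℝ → ℝ}
    (hcont : ContinuousOn (fun p : ℝ × ℝ => g p.1 p.2) (Set.Ici 0 ×ˢ Set.Ici 0))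
    (hg : ∀ t₁ t₂ : ℝ, 0 ≤ t₁ → 0 ≤ t₂ →
      g t₁ t₂ = ∫ r, G10 r.1 t₁ * G10 r.2 t₂ * (1 + (r.1 : ℝ)) * (1 + (r.2 : ℝ)) ∂ν) :
    IsBernstein2 g := by
  have heq : QuadrantEq g (kernelIntegral ν 0 0) := fun s t hs ht => by
    rw [hg s t hs.le ht.le, kernelIntegral]
    congr 1 with r
    simp only [kernelDeriv]
    ring
  refine ⟨hcont, (quadrantSmooth_kernelIntegral ν 0 0).congr heq, fun i j s t hs ht => ?_⟩
  have e1 := (heq.pd2.trans (pd2_kernelIntegral ν 0 0)).pd1.trans (pd1_kernelIntegral ν 0 1)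
  have e2 := (e1.pd2_iterate j).trans (pd2_iterate_kernelIntegral ν 1 1 j)
  have e3 := (e2.pd1_iterate i).trans (pd1_iterate_kernelIntegral ν 1 (1 + j) i)
  rw [e3 s t hs ht]
  exact neg_one_pow_mul_kernelIntegral_nonneg ν i j s t

end KernelIntegral

end Bernstein

/-- characterization of the continuous functions `g : [0,∞)² → ℝ` vanishing at
the boundary such that `g(‖x-y‖², ‖u-v‖²)` is PDI on `ℝ^d × ℝ^{d'}` for all `d, d'`. -/
theorem stmt10 (g : ℝ → ℝ → ℝ)
    (hg : ContinuousOn (fun p : ℝ × ℝ => g p.1 p.2) (Set.Ici 0 ×ˢ Set.Ici 0))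
    (hbd : ∀ t : ℝ, 0 ≤ t → g t 0 = 0 ∧ g 0 t = 0) :
    ((∀ d d' : ℕ,
        IsPDI (fun p q : EuclideanSpace ℝ (Fin d) × EuclideanSpace ℝ (Fin d') =>
          g (‖p.1 - q.1‖ ^ 2) (‖p.2 - q.2‖ ^ 2)))
      ↔ ∃ σ : Measure (NNReal × NNReal), IsFiniteMeasure σ ∧
          ∀ t₁ t₂ : ℝ, 0 ≤ t₁ → 0 ≤ t₂ →
            g t₁ t₂ =
              ∫ r, G10 r.1 t₁ * G10 r.2 t₂ * (1 + (r.1 : ℝ)) * (1 + (r.2 : ℝ)) ∂σ) ∧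
    ((∃ σ : Measure (NNReal × NNReal), IsFiniteMeasure σ ∧
        ∀ t₁ t₂ : ℝ, 0 ≤ t₁ → 0 ≤ t₂ →
          g t₁ t₂ =
            ∫ r, G10 r.1 t₁ * G10 r.2 t₂ * (1 + (r.1 : ℝ)) * (1 + (r.2 : ℝ)) ∂σ)
      ↔ IsBernstein2 g) := by
  have hex : (∀ h : ℝ, 0 < h → CompletelyMonotoneSeq (fun i j => mixedDiff g h h (i * h) (j * h))) →
      _ := exists_measure_G10 hg hbd
  refine ⟨⟨fun h => hex fun _ hh => (radialPDI_of_isPDI h).completelyMonotoneSeq hh, ?_⟩,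
    ⟨?_, fun h => hex fun _ hh => h.completelyMonotoneSeq hh⟩⟩
  · rintro ⟨ν, _, hν⟩ d d'
    exact isPDI_of_integral_G10 hν
  · rintro ⟨ν, _, hν⟩
    exact isBernstein2_of_integral_G10 ν hg hν
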